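/- arXiv:1211.2592 — 7 statements merged into one kernel-verified Lean document; each statement's English description precedes it below -/
import Mathlib

section
/- The second Weyl algebra A_2(ℂ) ≅ A_1(ℂ)[x][y; ∂/∂x] does not satisfy property (⋄): there exists a finitely generated (indeed cyclic) essential extension of a simple left A_2(ℂ)-module that is not Artinian. -/
universe u

/-- Property (⋄): every finitely generated essential extension of a simple left module
is Artinian. -/
def HasDiamond (A : Type*) [Ring A] : Prop :=
  ∀ (M : Type u) [AddCommGroup M] [Module A M], Module.Finite A M →
    ∀ N : Submodule A M, IsSimpleModule A ↥N →
      (∀ N' : Submodule A M, N ⊓ N' = ⊥ → N' = ⊥) → IsArtinian A M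

/-- `S = R[θ; d]` : `S` is free as a left `R`-module with basis `{θ^n}` (equivalently,
the evaluation map from polynomials is bijective) and `θ a = a θ + d(a)`. -/
structure IsDiffOpRing {R S : Type*} [Ring R] [Ring S] (d : R → R) (ι : R →+* S)
    (θ : S) : Prop where
  basis : Function.Bijective fun p : Polynomial R => p.sum fun i a => ι a * θ ^ i
  rel : ∀ a : R, θ * ι a = ι a * θ + ι (d a)

open Polynomial

namespace IsDiffOpRing

/-- A subring containing the coefficients and the variable of a differential operator ring is
everything. -/
theorem mem_of_subring {R S : Type*} [Ring R] [Ring S] {d : R → R} {ι : R →+* S} {θ : S}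
    (h : IsDiffOpRing d ι θ) (U : Subring S) (hι : ∀ a, ι a ∈ U) (hθ : θ ∈ U) (s : S) :
    s ∈ U := by
  obtain ⟨p, rfl⟩ := h.basis.2 s
  exact sum_mem fun i _ => mul_mem (hι _) (pow_mem hθ _)

/-- The universal property of a differential operator ring. -/
theorem exists_lift {R S T : Type*} [Ring R] [Ring S] [Ring T] {d : R → R} {ι : R →+* S} {θ : S}
    (h : IsDiffOpRing d ι θ) (φ : R →+* T) (τ : T)
    (hτ : ∀ a, τ * φ a = φ a * τ + φ (d a)) :
    ∃ Φ : S →+* T, (∀ a, Φ (ι a) = φ a) ∧ Φ θ = τ := by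
  let ev : R[X] →+ S :=
    { toFun := fun p => p.sum fun i a => ι a * θ ^ i
      map_zero' := by simp
      map_add' := fun p q => sum_add_index p q _ (by simp) (by simp [add_mul]) }
  let e : R[X] ≃+ S := AddEquiv.ofBijective ev h.basis
  let ev' : R[X] →+ T :=
    { toFun := fun p => p.sum fun i a => φ a * τ ^ i
      map_zero' := by simp
      map_add' := fun p q => sum_add_index p q _ (by simp) (by simp [add_mul]) }
  let f : S →+ T := ev'.comp e.symm.toAddMonoidHom
  have he (i : ℕ) (a : R) : e (monomial i a) = ι a * θ ^ i := by
    exact sum_monomial_index _ (fun i a => ι a * θ ^ i) (by simp)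
  have hf (i : ℕ) (a : R) : f (ι a * θ ^ i) = φ a * τ ^ i := by
    change ev' (e.symm _) = _
    rw [← he, e.symm_apply_apply]
    exact sum_monomial_index _ (fun i a => φ a * τ ^ i) (by simp)
  have ext (P : S → Prop) (hadd : ∀ x y, P x → P y → P (x + y))
      (hm : ∀ i a, P (ι a * θ ^ i)) (s : S) : P s := by
    rw [← e.apply_symm_apply s]
    induction e.symm s using Polynomial.induction_on' with
    | add p q hp hq => rw [map_add]; exact hadd _ _ hp hq
    | monomial n a => rw [he]; exact hm n a
  have hfι (a : R) (s : S) : f (ι a * s) = φ a * f s := by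
    refine ext (fun s => f (ι a * s) = φ a * f s) (fun x y hx hy => ?_) (fun i b => ?_) s
    · simp only [mul_add, map_add, hx, hy]
    · rw [← mul_assoc, ← map_mul, hf, hf, map_mul, mul_assoc]
  have hfθ (s : S) : f (θ * s) = τ * f s := by
    refine ext (fun s => f (θ * s) = τ * f s) (fun x y hx hy => ?_) (fun i b => ?_) s
    · simp only [mul_add, map_add, hx, hy]
    · rw [← mul_assoc, h.rel, add_mul, mul_assoc, ← pow_succ', map_add, hf, hf, hf, ← mul_assoc,
        hτ, add_mul, mul_assoc, ← pow_succ']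
  have hone : f 1 = 1 := by simpa using hf 0 1
  let U : Subring S :=
    { carrier := {s | ∀ s', f (s * s') = f s * f s'}
      mul_mem' := fun {a b} ha hb s' => by rw [mul_assoc, ha, hb, ha, mul_assoc]
      one_mem' := fun s' => by simp [hone]
      add_mem' := fun {a b} ha hb s' => by simp only [add_mul, map_add, ha s', hb s']
      zero_mem' := fun s' => by simp
      neg_mem' := fun {a} ha s' => by simp only [neg_mul, map_neg, ha s'] }
  have hι1 (a : R) : f (ι a) = φ a := by simpa [hone] using hfι a 1
  have hθ1 : f θ = τ := by simpa [hone] using hfθ 1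
  have hmul : ∀ s, s ∈ U := h.mem_of_subring U (fun a s' => by rw [hfι, hι1])
    (fun s' => by rw [hfθ, hθ1])
  exact ⟨{ f with map_one' := hone, map_mul' := fun a b => hmul a b }, hι1, hθ1⟩

end IsDiffOpRing

theorem mul_pow_of_mul_eq_mul_add_one {T : Type*} [Ring T] {a b : T} (h : b * a = a * b + 1)
    (n : ℕ) : b * a ^ n = a ^ n * b + n * a ^ (n - 1) := by
  induction n with
  | zero => simp
  | succ n ih =>
    rw [pow_succ, ← mul_assoc, ih, add_mul, mul_assoc, h, mul_add, mul_one, mul_assoc,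
      mul_assoc]
    rcases n with _ | n
    · simp
    · simp only [add_tsub_cancel_right, ← pow_succ]
      push_cast
      noncomm_ring

/-- Four endomorphisms satisfying the Weyl relations define an action of the second Weyl algebra,
whose image is the subalgebra they generate. -/
theorem exists_weyl_action {W : Type*} [Ring W] {ι₁ : Polynomial ℂ →+* W} {θ₁ : W}
    (hW : IsDiffOpRing (⇑(Polynomial.derivative (R := ℂ))) ι₁ θ₁)
    {S : Type*} [Ring S] {ι₂ : Polynomial W →+* S} {θ₂ : S}
    (hS : IsDiffOpRing (⇑(Polynomial.derivative (R := W))) ι₂ θ₂)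
    {T : Type*} [Ring T] [Algebra ℂ T] {a b x y : T} (hba : b * a = a * b + 1)
    (hxa : Commute a x) (hxb : Commute b x) (hya : Commute a y) (hyb : Commute b y)
    (hyx : y * x = x * y + 1) :
    ∃ Φ : S →+* T, Φ.range = (Algebra.adjoin ℂ {a, b, x, y}).toSubring := by
  obtain ⟨Φ₁, hΦ₁, hΦ₁θ⟩ := hW.exists_lift (aeval a : ℂ[X] →ₐ[ℂ] T).toRingHom b (fun p => by
    induction p using Polynomial.induction_on' with
    | add p q hp hq => simp only [map_add, mul_add, add_mul, hp, hq]; abel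
    | monomial n c =>
      have hn := mul_pow_of_mul_eq_mul_add_one hba n
      have hc := Algebra.commutes c b
      simp only [AlgHom.toRingHom_eq_coe, RingHom.coe_coe, aeval_monomial, derivative_monomial,
        map_mul, map_natCast]
      rw [← mul_assoc, ← hc, mul_assoc, hn, mul_add]
      simp only [mul_assoc])
  have hcomm (z : T) (hza : Commute a z) (hzb : Commute b z) (w : W) : Commute (Φ₁ w) z := by
    have := hW.mem_of_subring ((Subring.centralizer {z}).comap Φ₁) (fun p => by
      rw [Subring.mem_comap, hΦ₁, Subring.mem_centralizer_iff]
      intro m hm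
      rw [Set.mem_singleton_iff.mp hm]
      change Commute _ _
      induction p using Polynomial.induction_on' with
      | add p q hp hq => rw [map_add]; exact hp.add_right hq
      | monomial n c =>
        simp only [AlgHom.toRingHom_eq_coe, RingHom.coe_coe, aeval_monomial]
        have hc : Commute z (algebraMap ℂ T c) := (Algebra.commutes c z).symm
        exact hc.mul_right (hza.symm.pow_right n)) (by
      rw [Subring.mem_comap, hΦ₁θ, Subring.mem_centralizer_iff]
      rintro _ rfl
      exact hzb.symm) w
    rw [Subring.mem_comap, Subring.mem_centralizer_iff] at this
    exact (this z rfl).symm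
  obtain ⟨Φ, hΦ, hΦθ⟩ := hS.exists_lift (eval₂RingHom' Φ₁ x (hcomm x hxa hxb)) y (fun p => by
    change y * eval₂ Φ₁ x p = eval₂ Φ₁ x p * y + eval₂ Φ₁ x (derivative p)
    induction p using Polynomial.induction_on' with
    | add p q hp hq => simp only [map_add, eval₂_add, mul_add, add_mul, hp, hq]; abel
    | monomial n w =>
      have hn := mul_pow_of_mul_eq_mul_add_one hyx n
      have hc := hcomm y hya hyb w
      simp only [eval₂_monomial, derivative_monomial, map_mul, map_natCast]
      rw [← mul_assoc, ← hc.eq, mul_assoc, hn, mul_add]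
      simp only [mul_assoc])
  have hΦC (w : W) : Φ (ι₂ (C w)) = Φ₁ w := by
    rw [hΦ]; exact eval₂_C _ _
  have hΦX : Φ (ι₂ X) = x := by
    rw [hΦ]; exact eval₂_X _ _
  refine ⟨Φ, le_antisymm ?_ ?_⟩
  · rintro _ ⟨s, rfl⟩
    set A := (Algebra.adjoin ℂ {a, b, x, y}).toSubring with hA
    have mem (z : T) (hz : z ∈ ({a, b, x, y} : Set T)) : z ∈ A := Algebra.subset_adjoin hz
    have hW' (w : W) : Φ₁ w ∈ A := hW.mem_of_subring (A.comap Φ₁) (fun p => by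
      rw [Subring.mem_comap, hΦ₁]
      induction p using Polynomial.induction_on' with
      | add p q hp hq => rw [map_add]; exact add_mem hp hq
      | monomial n c =>
        simp only [AlgHom.toRingHom_eq_coe, RingHom.coe_coe, aeval_monomial]
        exact mul_mem (Subalgebra.algebraMap_mem _ c) (pow_mem (mem _ (by simp)) n))
      (by rw [Subring.mem_comap, hΦ₁θ]; exact mem _ (by simp)) w
    refine hS.mem_of_subring (A.comap Φ) (fun p => ?_) ?_ s
    · rw [Subring.mem_comap]
      induction p using Polynomial.induction_on' with
      | add p q hp hq => rw [map_add, map_add]; exact add_mem hp hq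
      | monomial n w =>
        rw [← C_mul_X_pow_eq_monomial, map_mul, map_mul, hΦC, map_pow, map_pow, hΦX]
        exact mul_mem (hW' w) (pow_mem (mem _ (by simp)) n)
    · rw [Subring.mem_comap, hΦθ]
      exact mem _ (by simp)
  · intro z hz
    induction (hz : z ∈ Algebra.adjoin ℂ {a, b, x, y}) using Algebra.adjoin_induction with
    | mem z hz =>
      rcases hz with rfl | rfl | rfl | rfl
      · exact ⟨ι₂ (C (ι₁ X)), by rw [hΦC, hΦ₁]; simp⟩
      · exact ⟨ι₂ (C θ₁), by rw [hΦC, hΦ₁θ]⟩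
      · exact ⟨ι₂ X, hΦX⟩
      · exact ⟨θ₂, hΦθ⟩
    | algebraMap c => exact ⟨ι₂ (C (ι₁ (C c))), by rw [hΦC, hΦ₁]; simp⟩
    | add z w _ _ hz hw => exact add_mem hz hw
    | mul z w _ _ hz hw => exact mul_mem hz hw

/-- An inductive criterion for differential simplicity of a polynomial ring: the coefficients are
`δ`-simple and `L` is a first order operator whose associated linear equations have no solution. -/
theorem one_mem_of_stable {R : Type*} [CommRing R] {δ : R → R} (h0 : δ 0 = 0) (h1 : δ 1 = 0)
    (hsimple : ∀ J : Ideal R, J ≠ ⊥ → (∀ r ∈ J, δ r ∈ J) → J = ⊤) {a b : R}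
    (hne : ∀ (r : R) (m : ℕ), 0 < m → δ r - a * r + m * b ≠ 0) {L : R[X] → R[X]}
    (hL : ∀ p k, (L p).coeff k =
      δ (p.coeff k) + k * a * p.coeff k + (k + 1) * b * p.coeff (k + 1))
    (I : Submodule R R[X]) (hI : I ≠ ⊥) (hLI : ∀ p ∈ I, L p ∈ I) : 1 ∈ I := by
  classical
  have hex : ∃ k, ∃ p ∈ I, p ≠ 0 ∧ p.natDegree = k := by
    obtain ⟨p, hp, hp0⟩ := (Submodule.ne_bot_iff I).1 hI
    exact ⟨_, p, hp, hp0, rfl⟩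
  obtain ⟨q, hq, hq0, hqk⟩ := Nat.find_spec hex
  set k := Nat.find hex with hk
  have hmin (p : R[X]) (hp : p ∈ I) (hd : p.natDegree ≤ k) (hc : p.coeff k = 0) : p = 0 := by
    by_contra hp0
    refine Nat.find_min hex (m := p.natDegree) ?_ ⟨p, hp, hp0, rfl⟩
    refine lt_of_le_of_ne hd fun h => hp0 ?_
    rwa [hk, ← h, coeff_natDegree, leadingCoeff_eq_zero] at hc
  have hLdeg (p : R[X]) (hd : p.natDegree ≤ k) : (L p).natDegree ≤ k := by
    rw [natDegree_le_iff_coeff_eq_zero]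
    intro n hn
    rw [hL, coeff_eq_zero_of_natDegree_lt (by omega), coeff_eq_zero_of_natDegree_lt (by omega), h0]
    simp
  let J : Ideal R :=
    { carrier := {c | ∃ p ∈ I, p.natDegree ≤ k ∧ p.coeff k = c}
      zero_mem' := ⟨0, zero_mem _, by simp, by simp⟩
      add_mem' := by
        rintro _ _ ⟨p, hp, hpd, rfl⟩ ⟨r, hr, hrd, rfl⟩
        exact ⟨p + r, add_mem hp hr, (natDegree_add_le _ _).trans (max_le hpd hrd), by simp⟩
      smul_mem' := by
        rintro c _ ⟨p, hp, hpd, rfl⟩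
        exact ⟨c • p, I.smul_mem c hp, (natDegree_smul_le _ _).trans hpd, by simp⟩ }
  have hJ : J = ⊤ := by
    refine hsimple J ?_ ?_
    · rw [Submodule.ne_bot_iff]
      refine ⟨_, ⟨q, hq, hqk.le, rfl⟩, ?_⟩
      rw [← hqk, coeff_natDegree, Ne, leadingCoeff_eq_zero]
      exact hq0
    · rintro _ ⟨p, hp, hpd, rfl⟩
      refine ⟨L p - (k * a) • p, sub_mem (hLI p hp) (I.smul_mem _ hp), ?_, ?_⟩
      · exact (natDegree_sub_le _ _).trans
          (max_le (hLdeg p hpd) ((natDegree_smul_le _ _).trans hpd))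
      · rw [coeff_sub, hL, coeff_smul, coeff_eq_zero_of_natDegree_lt (n := k + 1) (by omega)]
        simp
  obtain ⟨p, hp, hpd, hpc⟩ : (1 : R) ∈ J := hJ ▸ Submodule.mem_top
  have hzero : L p - (k * a) • p = 0 := by
    refine hmin _ (sub_mem (hLI p hp) (I.smul_mem _ hp)) ?_ ?_
    · exact (natDegree_sub_le _ _).trans
        (max_le (hLdeg p hpd) ((natDegree_smul_le _ _).trans hpd))
    · rw [coeff_sub, hL, coeff_smul, coeff_eq_zero_of_natDegree_lt (n := k + 1) (by omega), hpc, h1]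
      simp
  rcases Nat.eq_zero_or_pos k with hk0 | hkpos
  · rw [hk0] at hpd hpc
    rw [eq_C_of_natDegree_le_zero hpd, hpc, map_one] at hp
    exact hp
  · obtain ⟨j, hj⟩ : ∃ j, k = j + 1 := ⟨k - 1, by omega⟩
    have := congrArg (fun r => r.coeff j) hzero
    simp only [coeff_sub, hL, coeff_smul, coeff_zero, smul_eq_mul] at this
    rw [← hj, hpc, hj] at this
    refine absurd ?_ (hne (p.coeff j) k hkpos)
    rw [hj, ← this]
    push_cast
    ring

/-- A derivation acting on the coefficients of polynomials. -/
noncomputable def coeffDerivation {A : Type*} [CommRing A] [Algebra ℂ A] (d : Derivation ℂ A A) :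
    Derivation ℂ A[X] A[X] :=
  (PolynomialModule.equivPolynomialSelf (R := A)).toLinearMap.compDer d.mapCoeffs

theorem coeff_coeffDerivation {A : Type*} [CommRing A] [Algebra ℂ A] (d : Derivation ℂ A A)
    (p : A[X]) (k : ℕ) : (coeffDerivation d p).coeff k = d (p.coeff k) := rfl

@[simp]
theorem coeffDerivation_C {A : Type*} [CommRing A] [Algebra ℂ A] (d : Derivation ℂ A A)
    (c : A) : coeffDerivation d (C c) = C (d c) := by
  ext k
  rw [coeff_coeffDerivation, coeff_C, coeff_C]
  split_ifs <;> simp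

@[simp]
theorem coeffDerivation_X {A : Type*} [CommRing A] [Algebra ℂ A] (d : Derivation ℂ A A) :
    coeffDerivation d (X : A[X]) = 0 := by
  ext k
  rw [coeff_coeffDerivation, coeff_X]
  split_ifs <;> simp

/-- Formal differentiation, as a `ℂ`-linear derivation. -/
noncomputable def polyDerivation (A : Type*) [CommRing A] [Algebra ℂ A] :
    Derivation ℂ A[X] A[X] :=
  (derivative' (R := A)).restrictScalars ℂ

@[simp]
theorem polyDerivation_apply {A : Type*} [CommRing A] [Algebra ℂ A] (p : A[X]) :
    polyDerivation A p = derivative p := rfl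

theorem derivative_coeffDerivation {A : Type*} [CommRing A] [Algebra ℂ A] (d : Derivation ℂ A A)
    (p : A[X]) : derivative (coeffDerivation d p) = coeffDerivation d (derivative p) := by
  ext k
  simp only [coeff_derivative, coeff_coeffDerivation, Derivation.leibniz, Derivation.map_add,
    Derivation.map_natCast, Derivation.map_one_eq_zero, add_zero, smul_eq_mul]
  ring

theorem coeffDerivation_comm {A : Type*} [CommRing A] [Algebra ℂ A] {d e : Derivation ℂ A A}
    (h : ∀ c, d (e c) = e (d c)) (p : A[X]) :
    coeffDerivation d (coeffDerivation e p) = coeffDerivation e (coeffDerivation d p) := by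
  ext k
  simp only [coeff_coeffDerivation, h]

theorem eq_zero_of_derivative_add_mul_eq_C {c : ℂ[X]} {u e : ℂ} (hu : u ≠ 0)
    (h : derivative c + C u * (X * c) = C e) : c = 0 := by
  have := congrArg (fun r => r.coeff (c.natDegree + 1)) h
  simp only [coeff_add, coeff_derivative, coeff_C_mul, coeff_X_mul, coeff_C_succ] at this
  rw [coeff_eq_zero_of_natDegree_lt (by omega)] at this
  simpa [hu] using this

theorem derivative_stable_eq_top (J : Ideal ℂ[X]) (hJ : J ≠ ⊥)
    (h : ∀ r ∈ J, derivative r ∈ J) : J = ⊤ := by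
  rw [Ideal.eq_top_iff_one]
  refine one_mem_of_stable (δ := fun _ : ℂ => 0) rfl rfl ?_ (a := 0)
    (b := 1) ?_ (L := derivative) ?_ (J.restrictScalars ℂ) ?_ h
  · intro J hJ _
    exact (Ideal.eq_bot_or_top J).resolve_left hJ
  · intro r m hm
    simp [hm.ne']
  · intro p k
    rw [coeff_derivative]
    ring
  · simpa using hJ

/-- The derivation `∂_t + (1 + t y) ∂_y` of `ℂ[t][y]`. -/
noncomputable def simpleDerivation : Derivation ℂ ℂ[X][X] ℂ[X][X] :=
  coeffDerivation (polyDerivation ℂ) + (1 + C X * X : ℂ[X][X]) • polyDerivation ℂ[X]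

theorem coeff_simpleDerivation (p : ℂ[X][X]) (k : ℕ) : (simpleDerivation p).coeff k =
    derivative (p.coeff k) + (k : ℂ[X]) * (X : ℂ[X]) * p.coeff k +
      ((k : ℂ[X]) + 1) * 1 * p.coeff (k + 1) := by
  simp only [simpleDerivation, Derivation.add_apply, Derivation.smul_apply, coeff_add,
    coeff_coeffDerivation, polyDerivation_apply, smul_eq_mul, add_mul, one_mul, mul_assoc,
    coeff_C_mul, coeff_derivative]
  rcases k with _ | k
  · simp
  · rw [coeff_X_mul, coeff_derivative]
    push_cast
    ring

theorem simpleDerivation_stable_eq_top (J : Ideal ℂ[X][X]) (hJ : J ≠ ⊥)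
    (h : ∀ r ∈ J, simpleDerivation r ∈ J) : J = ⊤ := by
  rw [Ideal.eq_top_iff_one]
  refine one_mem_of_stable (δ := (derivative : ℂ[X] → ℂ[X])) (by simp) (by simp)
    derivative_stable_eq_top ?_ coeff_simpleDerivation (J.restrictScalars ℂ[X]) ?_ h
  · intro r m hm hr
    have h0 : r = 0 := eq_zero_of_derivative_add_mul_eq_C (u := -1) (e := -m) (by simp) (by
      simp only [map_neg, map_one, map_natCast]
      linear_combination hr)
    simp [h0, hm.ne'] at hr
  · simpa using hJ

/-- The commutator with `∂_t + (1 + t y) ∂_y + y` on symbols `ℂ[t][y][η]`. -/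
noncomputable def symbolOp (p : ℂ[X][X][X]) : ℂ[X][X][X] :=
  coeffDerivation simpleDerivation p - C (C X) * X * derivative p - derivative p

theorem coeff_symbolOp (p : ℂ[X][X][X]) (k : ℕ) : (symbolOp p).coeff k =
    simpleDerivation (p.coeff k) + (k : ℂ[X][X]) * (-C (X : ℂ[X])) * p.coeff k +
      ((k : ℂ[X][X]) + 1) * (-1) * p.coeff (k + 1) := by
  simp only [symbolOp, coeff_sub, coeff_coeffDerivation, mul_assoc, coeff_C_mul, coeff_derivative]
  rcases k with _ | k
  · simp
    ring
  · rw [coeff_X_mul, coeff_derivative]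
    push_cast
    ring

theorem one_mem_of_symbolOp_stable (I : Submodule ℂ[X][X] ℂ[X][X][X]) (hI : I ≠ ⊥)
    (h : ∀ p ∈ I, symbolOp p ∈ I) : 1 ∈ I := by
  refine one_mem_of_stable (δ := simpleDerivation) (map_zero _) (Derivation.map_one_eq_zero _)
    simpleDerivation_stable_eq_top ?_ coeff_symbolOp I hI h
  intro r m hm hr
  have hc : simpleDerivation r + C X * r - (m : ℂ[X][X]) = 0 := by linear_combination hr
  replace hc := congrArg (fun s => s.coeff r.natDegree) hc
  simp only [coeff_add, coeff_sub, coeff_simpleDerivation, coeff_C_mul, coeff_zero] at hc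
  rw [coeff_eq_zero_of_natDegree_lt (n := r.natDegree + 1) (by omega), mul_zero, add_zero] at hc
  have hmc : ((m : ℂ[X][X]).coeff r.natDegree) = C (if r.natDegree = 0 then (m : ℂ) else 0) := by
    rw [← C_eq_natCast, coeff_C]
    split_ifs <;> simp
  have h0 : r.coeff r.natDegree = 0 := eq_zero_of_derivative_add_mul_eq_C
    (u := r.natDegree + 1) (e := if r.natDegree = 0 then (m : ℂ) else 0)
    (Nat.cast_add_one_ne_zero _) (by
      rw [← hmc]
      simp only [map_add, map_one, map_natCast]
      linear_combination hc)
  rw [coeff_natDegree, leadingCoeff_eq_zero] at h0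
  simp [h0, hm.ne'] at hr

/-! The simple module: `ℂ[t][y][η]`, with `t`, `y` acting by multiplication and `∂_t`, `∂_y` acting
through left multiplication on `A₂ / A₂ (∂_t + (1 + t y) ∂_y + y)`. -/

/-- Action of `t` on the simple module. -/
noncomputable def symT : Module.End ℂ ℂ[X][X][X] := LinearMap.mulLeft ℂ (C (C X))

/-- Action of `y` on the simple module. -/
noncomputable def symY : Module.End ℂ ℂ[X][X][X] := LinearMap.mulLeft ℂ (C X)

/-- Action of `∂_y` on the simple module. -/
noncomputable def symDy : Module.End ℂ ℂ[X][X][X] :=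
  (coeffDerivation (polyDerivation ℂ[X])).toLinearMap + LinearMap.mulLeft ℂ X

/-- Action of `∂_t` on the simple module. -/
noncomputable def symDt : Module.End ℂ ℂ[X][X][X] :=
  (coeffDerivation (coeffDerivation (polyDerivation ℂ))).toLinearMap -
    LinearMap.mulLeft ℂ (X * (1 + C (C X) * C X) + C X) -
    LinearMap.mulLeft ℂ (C (C X) * X + 1) ∘ₗ (polyDerivation ℂ[X][X]).toLinearMap

theorem symT_apply (p : ℂ[X][X][X]) : symT p = C (C X) * p := rfl

theorem symY_apply (p : ℂ[X][X][X]) : symY p = C X * p := rfl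

theorem symDy_apply (p : ℂ[X][X][X]) :
    symDy p = coeffDerivation (polyDerivation ℂ[X]) p + X * p := rfl

theorem symDt_apply (p : ℂ[X][X][X]) :
    symDt p = coeffDerivation (coeffDerivation (polyDerivation ℂ)) p -
      (X * (1 + C (C X) * C X) + C X) * p - (C (C X) * X + 1) * derivative p := rfl

theorem symDt_symT (p : ℂ[X][X][X]) : symDt (symT p) = symT (symDt p) + p := by
  simp only [symDt_apply, symT_apply, Derivation.leibniz, coeffDerivation_C, polyDerivation_apply,
    derivative_X, derivative_mul, derivative_C, map_one, smul_eq_mul]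
  ring

theorem symDt_symY (p : ℂ[X][X][X]) : symDt (symY p) = symY (symDt p) := by
  simp only [symDt_apply, symY_apply, Derivation.leibniz, coeffDerivation_C, coeffDerivation_X,
    derivative_mul, derivative_C, map_zero, smul_eq_mul]
  ring

theorem symDt_symDy (p : ℂ[X][X][X]) : symDt (symDy p) = symDy (symDt p) := by
  have h := coeffDerivation_comm (d := coeffDerivation (polyDerivation ℂ))
    (e := polyDerivation ℂ[X]) (fun c => (derivative_coeffDerivation _ c).symm) p
  simp only [symDt_apply, symDy_apply, Derivation.leibniz, coeffDerivation_C, coeffDerivation_X,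
    derivative_mul, derivative_C, derivative_X, map_zero, map_one, smul_eq_mul, map_add, map_sub,
    polyDerivation_apply, h, derivative_coeffDerivation, Derivation.map_one_eq_zero]
  ring

theorem symDy_symY (p : ℂ[X][X][X]) : symDy (symY p) = symY (symDy p) + p := by
  simp only [symDy_apply, symY_apply, Derivation.leibniz, coeffDerivation_C, polyDerivation_apply,
    derivative_X, map_one, smul_eq_mul]
  ring

theorem symDy_symT (p : ℂ[X][X][X]) : symDy (symT p) = symT (symDy p) := by
  simp only [symDy_apply, symT_apply, Derivation.leibniz, coeffDerivation_C, polyDerivation_apply,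
    derivative_C, map_zero, smul_eq_mul]
  ring

theorem coeffDerivation_simpleDerivation (p : ℂ[X][X][X]) :
    coeffDerivation simpleDerivation p = coeffDerivation (coeffDerivation (polyDerivation ℂ)) p +
      (1 + C (C X) * C X) * coeffDerivation (polyDerivation ℂ[X]) p := by
  rw [← map_one C, ← C_mul, ← C_add]
  ext1 k
  rw [coeff_add, coeff_C_mul]
  rfl

theorem symbolOp_eq (p : ℂ[X][X][X]) :
    symbolOp p = symDt p + (symDy p + symT (symY (symDy p))) + symY p := by
  simp only [symbolOp, coeffDerivation_simpleDerivation, symDt_apply, symDy_apply, symT_apply,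
    symY_apply]
  ring

theorem C_C_mul_mem {U : Submodule ℂ ℂ[X][X][X]} (h : ∀ p ∈ U, C (C X) * p ∈ U) (c : ℂ[X])
    {p : ℂ[X][X][X]} (hp : p ∈ U) : C (C c) * p ∈ U := by
  induction c using Polynomial.induction_on generalizing p with
  | C z =>
    have hz : C (C (C z)) * p = z • p := (Algebra.smul_def z p).symm
    rw [hz]
    exact U.smul_mem z hp
  | add r s hr hs => rw [map_add, map_add, add_mul]; exact add_mem (hr hp) (hs hp)
  | monomial n z ih =>
    rw [pow_succ, ← mul_assoc, map_mul, map_mul, mul_assoc]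
    exact ih (h p hp)

theorem sym_stable_C_mul {U : Submodule ℂ ℂ[X][X][X]} (hT : ∀ p ∈ U, symT p ∈ U)
    (hY : ∀ p ∈ U, symY p ∈ U) (c : ℂ[X][X]) {p : ℂ[X][X][X]} (hp : p ∈ U) : C c * p ∈ U := by
  induction c using Polynomial.induction_on generalizing p with
  | C z => exact C_C_mul_mem hT z hp
  | add r s hr hs => rw [map_add, add_mul]; exact add_mem (hr hp) (hs hp)
  | monomial n z ih =>
    rw [pow_succ, ← mul_assoc, map_mul, mul_assoc]
    exact ih (hY p hp)

/-- `ℂ[t][y][η]` is simple under the four operators. -/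
theorem sym_stable_eq_top {U : Submodule ℂ ℂ[X][X][X]} (hT : ∀ p ∈ U, symT p ∈ U)
    (hY : ∀ p ∈ U, symY p ∈ U) (hDt : ∀ p ∈ U, symDt p ∈ U) (hDy : ∀ p ∈ U, symDy p ∈ U)
    (hU : U ≠ ⊥) : U = ⊤ := by
  have hone : (1 : ℂ[X][X][X]) ∈ U := by
    refine one_mem_of_symbolOp_stable
      { U with smul_mem' := fun c p hp => by
                rw [smul_eq_C_mul]
                exact sym_stable_C_mul hT hY c hp } ?_ ?_
    · obtain ⟨p, hp, hp0⟩ := (Submodule.ne_bot_iff U).1 hU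
      exact (Submodule.ne_bot_iff _).2 ⟨p, hp, hp0⟩
    · intro p hp
      rw [symbolOp_eq]
      exact add_mem (add_mem (hDt p hp) (add_mem (hDy p hp) (hT _ (hY _ (hDy p hp))))) (hY p hp)
  have hX (k : ℕ) : (X ^ k : ℂ[X][X][X]) ∈ U := by
    induction k with
    | zero => simpa using hone
    | succ k ih =>
      have := hDy _ ih
      rwa [symDy_apply, Derivation.leibniz_pow, coeffDerivation_X, smul_zero, smul_zero, zero_add,
        ← pow_succ'] at this
  rw [Submodule.eq_top_iff']
  intro p
  induction p using Polynomial.induction_on' with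
  | add p q hp hq => exact add_mem hp hq
  | monomial n c =>
    rw [← C_mul_X_pow_eq_monomial]
    exact sym_stable_C_mul hT hY c (hX n)

/-! The quotient module `A₂ / A₂ t`, realised as `ℂ[y][η][s]` with `∂_t` acting as `s`. -/

/-- Action of `y` on `ℂ[y][η][s]`. -/
noncomputable def quotY : Module.End ℂ ℂ[X][X][X] := LinearMap.mulLeft ℂ (C (C X))

/-- Action of `∂_y` on `ℂ[y][η][s]`. -/
noncomputable def quotDy : Module.End ℂ ℂ[X][X][X] :=
  (coeffDerivation (coeffDerivation (polyDerivation ℂ))).toLinearMap + LinearMap.mulLeft ℂ (C X)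

/-- Action of `∂_t` on `ℂ[y][η][s]`. -/
noncomputable def quotDt : Module.End ℂ ℂ[X][X][X] := LinearMap.mulLeft ℂ X

/-- Action of `t` on `ℂ[y][η][s]`. -/
noncomputable def quotT : Module.End ℂ ℂ[X][X][X] := -(polyDerivation ℂ[X][X]).toLinearMap

theorem quotY_apply (p : ℂ[X][X][X]) : quotY p = C (C X) * p := rfl

theorem quotDy_apply (p : ℂ[X][X][X]) :
    quotDy p = coeffDerivation (coeffDerivation (polyDerivation ℂ)) p + C X * p := rfl

theorem quotDt_apply (p : ℂ[X][X][X]) : quotDt p = X * p := rfl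

theorem quotT_apply (p : ℂ[X][X][X]) : quotT p = -derivative p := rfl

theorem quotT_C (b : ℂ[X][X]) : quotT (C b) = 0 := by
  rw [quotT_apply, derivative_C]
  exact neg_zero (G := ℂ[X][X][X])

theorem quotDy_quotY (p : ℂ[X][X][X]) : quotDy (quotY p) = quotY (quotDy p) + p := by
  simp only [quotDy_apply, quotY_apply, Derivation.leibniz, coeffDerivation_C,
    polyDerivation_apply, derivative_X, map_one, smul_eq_mul]
  ring

theorem quotDt_quotT (p : ℂ[X][X][X]) : quotDt (quotT p) = quotT (quotDt p) + p := by
  simp only [quotDt_apply, quotT_apply, derivative_mul, derivative_X]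
  ring

theorem quotDt_quotY (p : ℂ[X][X][X]) : quotDt (quotY p) = quotY (quotDt p) := by
  simp only [quotDt_apply, quotY_apply]
  ring

theorem quotDt_quotDy (p : ℂ[X][X][X]) : quotDt (quotDy p) = quotDy (quotDt p) := by
  simp only [quotDt_apply, quotDy_apply, Derivation.leibniz, coeffDerivation_X, smul_eq_mul]
  ring

theorem quotT_quotY (p : ℂ[X][X][X]) : quotT (quotY p) = quotY (quotT p) := by
  simp only [quotT_apply, quotY_apply, derivative_mul, derivative_C]
  ring

theorem quotT_quotDy (p : ℂ[X][X][X]) : quotT (quotDy p) = quotDy (quotT p) := by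
  simp only [quotT_apply, quotDy_apply, derivative_mul, derivative_C, derivative_add,
    derivative_coeffDerivation, map_neg]
  ring

theorem quot_stable_eq_top {U : Submodule ℂ ℂ[X][X][X]} (hY : ∀ p ∈ U, quotY p ∈ U)
    (hDt : ∀ p ∈ U, quotDt p ∈ U) (hDy : ∀ p ∈ U, quotDy p ∈ U) (hone : 1 ∈ U) : U = ⊤ := by
  have hX (k : ℕ) : (C X ^ k : ℂ[X][X][X]) ∈ U := by
    induction k with
    | zero => simpa using hone
    | succ k ih =>
      have := hDy _ ih
      rwa [quotDy_apply, Derivation.leibniz_pow, coeffDerivation_C, coeffDerivation_X, map_zero,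
        smul_zero, smul_zero, zero_add, ← pow_succ'] at this
  have hC (b : ℂ[X][X]) : C b ∈ U := by
    induction b using Polynomial.induction_on' with
    | add p q hp hq => rw [map_add]; exact add_mem hp hq
    | monomial n c =>
      rw [← C_mul_X_pow_eq_monomial, map_mul, map_pow]
      exact C_C_mul_mem hY c (hX n)
  rw [Submodule.eq_top_iff']
  intro p
  induction p using Polynomial.induction_on with
  | C b => exact hC b
  | add p q hp hq => exact add_mem hp hq
  | monomial n b ih =>
    have h := hDt _ ih
    have e : quotDt (C b * X ^ n) = C b * X ^ (n + 1) := by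
      rw [quotDt_apply]
      ring
    rwa [e] at h

/-- The inclusion `ℂ[y][η] → ℂ[t][y][η]`. -/
noncomputable def symInclusion : ℂ[X][X] →ₐ[ℂ] ℂ[X][X][X] :=
  mapAlgHom (mapAlgHom (Algebra.ofId ℂ ℂ[X]))

theorem symInclusion_coeff_coeff (b : ℂ[X][X]) (i j : ℕ) :
    ((symInclusion b).coeff i).coeff j = C ((b.coeff i).coeff j) := by
  simp [symInclusion]

theorem symInclusion_X : symInclusion X = X := Polynomial.map_X _

theorem symInclusion_C_X : symInclusion (C X) = C X := by
  change Polynomial.map _ (C X) = _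
  rw [map_C]
  change C (Polynomial.map _ X) = _
  rw [map_X]

theorem symInclusion_coeffDerivation (b : ℂ[X][X]) :
    symInclusion (coeffDerivation (polyDerivation ℂ) b) =
      coeffDerivation (polyDerivation ℂ[X]) (symInclusion b) := by
  ext1 i
  ext1 j
  rw [symInclusion_coeff_coeff]
  simp only [coeff_coeffDerivation, polyDerivation_apply, coeff_derivative,
    symInclusion_coeff_coeff]
  simp

/-- `t n + b = 0` with `b` free of `t` forces `b = 0`. -/
theorem eq_zero_of_symT_add_symInclusion {n : ℂ[X][X][X]} {b : ℂ[X][X]}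
    (h : symT n + symInclusion b = 0) : b = 0 := by
  ext1 i
  ext1 j
  have := congrArg (fun p => ((p.coeff i).coeff j).coeff 0) h
  simpa [symT_apply, symInclusion_coeff_coeff] using this

/-- The map `∑ sᵏ bₖ ↦ ∑ ∂_tᵏ bₖ`. -/
noncomputable def symEval : ℂ[X][X][X] →ₗ[ℂ] ℂ[X][X][X] :=
  lsum fun k => (symDt ^ k) ∘ₗ symInclusion.toLinearMap

theorem symEval_monomial (k : ℕ) (b : ℂ[X][X]) :
    symEval (monomial k b) = (symDt ^ k) (symInclusion b) :=
  sum_monomial_index _ _ (by simp)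

theorem symEval_C (b : ℂ[X][X]) : symEval (C b) = symInclusion b := by
  rw [← monomial_zero_left, symEval_monomial]
  rfl

theorem symEval_quotDt (q : ℂ[X][X][X]) : symEval (quotDt q) = symDt (symEval q) := by
  induction q using Polynomial.induction_on' with
  | add p q hp hq => simp only [map_add, hp, hq]
  | monomial n b =>
    rw [quotDt_apply, X_mul_monomial, symEval_monomial, symEval_monomial, pow_succ',
      Module.End.mul_apply]

theorem symEval_quotY (q : ℂ[X][X][X]) : symEval (quotY q) = symY (symEval q) := by
  induction q using Polynomial.induction_on' with
  | add p q hp hq => simp only [map_add, hp, hq]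
  | monomial n b =>
    have hc : Commute (symDt ^ n) symY := Commute.pow_left (LinearMap.ext symDt_symY) n
    rw [quotY_apply, C_mul_monomial, symEval_monomial, symEval_monomial, map_mul, symInclusion_C_X,
      ← symY_apply]
    exact LinearMap.congr_fun hc.eq _

theorem symEval_quotDy (q : ℂ[X][X][X]) : symEval (quotDy q) = symDy (symEval q) := by
  induction q using Polynomial.induction_on' with
  | add p q hp hq => simp only [map_add, hp, hq]
  | monomial n b =>
    have hc : Commute (symDt ^ n) symDy := Commute.pow_left (LinearMap.ext symDt_symDy) n
    have hm : quotDy (monomial n b) =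
        monomial n (coeffDerivation (polyDerivation ℂ) b + X * b) := by
      rw [quotDy_apply, C_mul_monomial, map_add]
      congr 1
      ext1 k
      rw [coeff_coeffDerivation, coeff_monomial, coeff_monomial]
      split_ifs
      · rfl
      · exact map_zero _
    rw [hm, symEval_monomial, symEval_monomial, map_add, map_mul, symInclusion_X,
      symInclusion_coeffDerivation, ← symDy_apply]
    exact LinearMap.congr_fun hc.eq _

/-! The nonsplit extension of the quotient module by the simple module. -/

/-- Action of `t` on the extension. -/
noncomputable def extT : Module.End ℂ (ℂ[X][X][X] × ℂ[X][X][X]) :=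
  (symT ∘ₗ LinearMap.fst ℂ _ _ + symEval ∘ₗ LinearMap.snd ℂ _ _).prod
    (quotT ∘ₗ LinearMap.snd ℂ _ _)

/-- Action of `∂_t` on the extension. -/
noncomputable def extDt : Module.End ℂ (ℂ[X][X][X] × ℂ[X][X][X]) := symDt.prodMap quotDt

/-- Action of `y` on the extension. -/
noncomputable def extY : Module.End ℂ (ℂ[X][X][X] × ℂ[X][X][X]) := symY.prodMap quotY

/-- Action of `∂_y` on the extension. -/
noncomputable def extDy : Module.End ℂ (ℂ[X][X][X] × ℂ[X][X][X]) := symDy.prodMap quotDy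

theorem extT_apply (v : ℂ[X][X][X] × ℂ[X][X][X]) :
    extT v = (symT v.1 + symEval v.2, quotT v.2) := rfl

theorem extDt_apply (v : ℂ[X][X][X] × ℂ[X][X][X]) : extDt v = (symDt v.1, quotDt v.2) := rfl

theorem extY_apply (v : ℂ[X][X][X] × ℂ[X][X][X]) : extY v = (symY v.1, quotY v.2) := rfl

theorem extDy_apply (v : ℂ[X][X][X] × ℂ[X][X][X]) : extDy v = (symDy v.1, quotDy v.2) := rfl

theorem extDy_mul_extY : extDy * extY = extY * extDy + 1 :=
  LinearMap.ext fun v => Prod.ext (symDy_symY v.1) (quotDy_quotY v.2)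

theorem extDt_mul_extT : extDt * extT = extT * extDt + 1 :=
  LinearMap.ext fun v => Prod.ext (by
    change symDt (symT v.1 + symEval v.2) = symT (symDt v.1) + symEval (quotDt v.2) + v.1
    rw [map_add, symDt_symT, symEval_quotDt]
    abel) (quotDt_quotT v.2)

theorem commute_extY_extT : Commute extY extT :=
  LinearMap.ext fun v => Prod.ext (by
    change symY (symT v.1 + symEval v.2) = symT (symY v.1) + symEval (quotY v.2)
    rw [map_add, symEval_quotY]
    simp only [symY_apply, symT_apply]
    ring)
    (quotT_quotY v.2).symm

theorem commute_extDy_extT : Commute extDy extT :=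
  LinearMap.ext fun v => Prod.ext (by
    change symDy (symT v.1 + symEval v.2) = symT (symDy v.1) + symEval (quotDy v.2)
    rw [map_add, symEval_quotDy, symDy_symT]) (quotT_quotDy v.2).symm

theorem commute_extY_extDt : Commute extY extDt :=
  LinearMap.ext fun v => Prod.ext (symDt_symY v.1).symm (quotDt_quotY v.2).symm

theorem commute_extDy_extDt : Commute extDy extDt :=
  LinearMap.ext fun v => Prod.ext (symDt_symDy v.1).symm (quotDt_quotDy v.2).symm

/-- A subspace stable under `t` that meets the simple submodule trivially is zero. -/
theorem ext_stable_eq_zero {U : Submodule ℂ (ℂ[X][X][X] × ℂ[X][X][X])}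
    (hT : ∀ v ∈ U, extT v ∈ U) (hU : ∀ v ∈ U, v.2 = 0 → v = 0)
    {v : ℂ[X][X][X] × ℂ[X][X][X]} (hv : v ∈ U) : v = 0 := by
  have base (n : ℂ[X][X][X]) (b : ℂ[X][X]) (h : (n, C b) ∈ U) : b = 0 := by
    have h1 := hU _ (hT _ h) (quotT_C b)
    rw [extT_apply, symEval_C] at h1
    exact eq_zero_of_symT_add_symInclusion (congrArg Prod.fst h1)
  have key (d : ℕ) : ∀ v ∈ U, v.2.natDegree ≤ d → v.2 = 0 := by
    have const {n q : ℂ[X][X][X]} (h : (n, q) ∈ U) (hq : q = C (q.coeff 0)) : q = 0 := by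
      rw [hq] at h
      rw [hq, base _ _ h, map_zero]
    induction d with
    | zero => exact fun v h hd => const h (eq_C_of_natDegree_le_zero hd)
    | succ d ih =>
      intro v h hd
      have h1 : -derivative v.2 = 0 := ih _ (hT _ h) <|
        ((natDegree_neg (derivative v.2)).trans_le (natDegree_derivative_le _)).trans (by omega)
      exact const h (eq_C_of_natDegree_eq_zero
        (derivative_eq_zero.1 ((neg_eq_zero (α := ℂ[X][X][X])).1 h1)))
  exact hU v hv (key _ v hv le_rfl)

/-- The extension is generated by `(0, 1)`. -/
theorem ext_stable_eq_top {U : Submodule ℂ (ℂ[X][X][X] × ℂ[X][X][X])}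
    (hT : ∀ v ∈ U, extT v ∈ U) (hDt : ∀ v ∈ U, extDt v ∈ U) (hY : ∀ v ∈ U, extY v ∈ U)
    (hDy : ∀ v ∈ U, extDy v ∈ U) (hone : ((0, 1) : ℂ[X][X][X] × ℂ[X][X][X]) ∈ U) : U = ⊤ := by
  have h1 : U.comap (LinearMap.inl ℂ _ _) = ⊤ := by
    refine sym_stable_eq_top (fun p hp => ?_) (fun p hp => ?_) (fun p hp => ?_) (fun p hp => ?_) ?_
    · simpa [extT_apply] using hT _ hp
    · simpa [extY_apply] using hY _ hp
    · simpa [extDt_apply] using hDt _ hp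
    · simpa [extDy_apply] using hDy _ hp
    · refine (Submodule.ne_bot_iff _).2 ⟨1, ?_, one_ne_zero⟩
      have := hT _ hone
      rw [extT_apply, ← map_one C, symEval_C, quotT_C] at this
      simpa using this
  have h2 : U.comap (LinearMap.inr ℂ _ _) = ⊤ := by
    refine quot_stable_eq_top (fun p hp => ?_) (fun p hp => ?_) (fun p hp => ?_) hone
    · simpa [extY_apply] using hY _ hp
    · simpa [extDt_apply] using hDt _ hp
    · simpa [extDy_apply] using hDy _ hp
  rw [Submodule.eq_top_iff'] at h1 h2 ⊢
  intro v
  have h1' : (v.1, 0) ∈ U := h1 v.1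
  have h2' : (0, v.2) ∈ U := h2 v.2
  simpa using add_mem h1' h2'

/-- The subspace of pairs whose second component is divisible by `ηᵏ`. -/
noncomputable def etaFiltration (k : ℕ) : Submodule ℂ (ℂ[X][X][X] × ℂ[X][X][X]) :=
  ((Ideal.span {(C X ^ k : ℂ[X][X][X])}).restrictScalars ℂ).comap (LinearMap.snd ℂ _ _)

theorem mem_etaFiltration {k : ℕ} {v : ℂ[X][X][X] × ℂ[X][X][X]} :
    v ∈ etaFiltration k ↔ (C X ^ k : ℂ[X][X][X]) ∣ v.2 := by
  change v.2 ∈ Ideal.span {(C X ^ k : ℂ[X][X][X])} ↔ _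
  exact Ideal.mem_span_singleton (α := ℂ[X][X][X])

theorem etaFiltration_stable (k : ℕ) {v : ℂ[X][X][X] × ℂ[X][X][X]} (hv : v ∈ etaFiltration k) :
    extT v ∈ etaFiltration k ∧ extDt v ∈ etaFiltration k ∧ extY v ∈ etaFiltration k ∧
      extDy v ∈ etaFiltration k := by
  simp only [mem_etaFiltration, extT_apply, extDt_apply, extY_apply, extDy_apply] at hv ⊢
  obtain ⟨q, hq⟩ := hv
  rw [hq]
  refine ⟨⟨-derivative q, ?_⟩, ⟨X * q, ?_⟩, ⟨C (C X) * q, ?_⟩, ⟨quotDy q, ?_⟩⟩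
  · rw [quotT_apply, ← map_pow, derivative_C_mul]
    ring
  · rw [quotDt_apply]
    ring
  · rw [quotY_apply]
    ring
  · rw [quotDy_apply, quotDy_apply, Derivation.leibniz, Derivation.leibniz_pow, coeffDerivation_C,
      coeffDerivation_X, map_zero, smul_zero, smul_zero, smul_zero, add_zero, smul_eq_mul]
    ring

theorem not_mem_etaFiltration_succ (k : ℕ) :
    ((0, C X ^ k) : ℂ[X][X][X] × ℂ[X][X][X]) ∉ etaFiltration (k + 1) := by
  rw [mem_etaFiltration, ← map_pow, ← map_pow]
  intro h
  have := C_dvd_iff_dvd_coeff _ _ |>.1 h 0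
  rw [coeff_C_zero] at this
  have := X_pow_dvd_iff.1 this k (by omega)
  simp at this

theorem HasDiamond.isArtinian {A : Type*} [Ring A] (h : HasDiamond.{u} A) {V : Type}
    [AddCommGroup V] [Module A V] [Module.Finite A V] {N : Submodule A V} (hN : IsAtom N)
    (hV : ∀ N' : Submodule A V, N ⊓ N' = ⊥ → N' = ⊥) : IsArtinian A V := by
  let e : V ≃ₗ[A] ULift.{u} V := ULift.moduleEquiv.symm
  let o : Submodule A V ≃o Submodule A (ULift.{u} V) := Submodule.orderIsoMapComap e
  refine e.isArtinian_iff.2 (h _ (Module.Finite.equiv e) (o N)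
    (isSimpleModule_iff_isAtom.2 ((o.isAtom_iff N).2 hN)) fun N' hN' => ?_)
  obtain ⟨P, rfl⟩ := o.surjective N'
  rw [← o.map_inf, map_eq_bot_iff] at hN'
  rw [hV P hN', o.map_bot]

theorem apply_mem_of_mem_adjoin {V : Type*} [AddCommGroup V] [Module ℂ V]
    {s : Set (Module.End ℂ V)} {U : Submodule ℂ V} (h : ∀ f ∈ s, ∀ v ∈ U, f v ∈ U)
    {f : Module.End ℂ V} (hf : f ∈ Algebra.adjoin ℂ s) : ∀ v ∈ U, f v ∈ U := by
  induction hf using Algebra.adjoin_induction with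
  | mem f hf => exact h f hf
  | algebraMap c => exact fun v hv => U.smul_mem c hv
  | add f g _ _ hf hg => exact fun v hv => U.add_mem (hf v hv) (hg v hv)
  | mul f g _ _ hf hg => exact fun v hv => hf _ (hg v hv)

/-- A criterion for the failure of `HasDiamond` in terms of the subspaces of a complex vector
space that are stable under a set of operators generating the action. -/
theorem not_hasDiamond_of_action {S : Type*} [Ring S] {V : Type} [AddCommGroup V] [Module ℂ V]
    {s : Set (Module.End ℂ V)} (Φ : S →+* Module.End ℂ V)
    (hΦ : Φ.range = (Algebra.adjoin ℂ s).toSubring)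
    {N : Submodule ℂ V} (hN : ∀ f ∈ s, ∀ v ∈ N, f v ∈ N) (hN0 : N ≠ ⊥)
    (hatom : ∀ U ≤ N, (∀ f ∈ s, ∀ v ∈ U, f v ∈ U) → U ≠ ⊥ → N ≤ U)
    {w : V} (hw : ∀ U : Submodule ℂ V, (∀ f ∈ s, ∀ v ∈ U, f v ∈ U) → w ∈ U → U = ⊤)
    (hess : ∀ U : Submodule ℂ V, (∀ f ∈ s, ∀ v ∈ U, f v ∈ U) → N ⊓ U = ⊥ → U = ⊥)
    {F : ℕ → Submodule ℂ V} (hF : ∀ k, ∀ f ∈ s, ∀ v ∈ F k, f v ∈ F k) (hanti : Antitone F)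
    (hne : ∀ k, F k ≠ F (k + 1)) : ¬ HasDiamond.{u} S := by
  intro hD
  let _ : Module S V := Module.compHom V Φ
  have mem_range (f : Module.End ℂ V) : (∃ r, Φ r = f) ↔ f ∈ Algebra.adjoin ℂ s :=
    SetLike.ext_iff.1 hΦ f
  have extend {U : Submodule ℂ V} (h : ∀ f ∈ s, ∀ v ∈ U, f v ∈ U) :
      ∃ P : Submodule S V, ∀ v, v ∈ P ↔ v ∈ U :=
    ⟨{ U with smul_mem' := fun r v hv =>
        apply_mem_of_mem_adjoin h ((mem_range _).1 ⟨r, rfl⟩) v hv }, fun v => Iff.rfl⟩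
  have apply_mem (P : Submodule S V) {f : Module.End ℂ V} (hf : f ∈ Algebra.adjoin ℂ s) {v : V}
      (hv : v ∈ P) : f v ∈ P := by
    obtain ⟨r, rfl⟩ := (mem_range f).2 hf
    exact P.smul_mem r hv
  have restrict (P : Submodule S V) :
      ∃ U : Submodule ℂ V, (∀ v, v ∈ U ↔ v ∈ P) ∧ ∀ f ∈ s, ∀ v ∈ U, f v ∈ U :=
    ⟨{ P with smul_mem' := fun c v hv => apply_mem P (Subalgebra.algebraMap_mem _ c) hv },
      fun v => Iff.rfl, fun f hf v hv => apply_mem P (Algebra.subset_adjoin hf) hv⟩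
  obtain ⟨M, hM⟩ := extend hN
  have : Module.Finite S V := by
    obtain ⟨U, hU, hs⟩ := restrict (Submodule.span S {w})
    refine ⟨Submodule.fg_def.2 ⟨{w}, Set.finite_singleton w, Submodule.eq_top_iff'.2 fun v => ?_⟩⟩
    rw [← hU, hw U hs ((hU w).2 (Submodule.mem_span_singleton_self w))]
    trivial
  have hMatom : IsAtom M := by
    obtain ⟨n, hn, hn0⟩ := (Submodule.ne_bot_iff _).1 hN0
    refine ⟨(Submodule.ne_bot_iff _).2 ⟨n, (hM n).2 hn, hn0⟩, fun P hP =>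
      by_contra fun hP0 => hP.not_ge fun v hv => ?_⟩
    obtain ⟨U, hU, hs⟩ := restrict P
    obtain ⟨p, hp, hp0⟩ := (Submodule.ne_bot_iff _).1 hP0
    exact (hU v).1 (hatom U (fun x hx => (hM x).1 (hP.le ((hU x).1 hx))) hs
      ((Submodule.ne_bot_iff _).2 ⟨p, (hU p).2 hp, hp0⟩) ((hM v).1 hv))
  have hMess (P : Submodule S V) (hP : M ⊓ P = ⊥) : P = ⊥ := by
    obtain ⟨U, hU, hs⟩ := restrict P
    have hU0 := hess U hs ((Submodule.eq_bot_iff _).2 fun v hv =>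
      (Submodule.eq_bot_iff _).1 hP v ⟨(hM v).2 hv.1, (hU v).1 hv.2⟩)
    exact (Submodule.eq_bot_iff _).2 fun v hv => (Submodule.eq_bot_iff _).1 hU0 v ((hU v).2 hv)
  have := hD.isArtinian hMatom hMess
  choose G hG using fun k => extend (hF k)
  obtain ⟨k, hk⟩ := IsArtinian.monotone_stabilizes
    (⟨fun k => OrderDual.toDual (G k), fun i j hij v hv =>
      (hG i v).2 (hanti hij ((hG j v).1 hv))⟩ : ℕ →o (Submodule S V)ᵒᵈ)
  have hk : G k = G (k + 1) := hk _ k.le_succ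
  exact hne k (Submodule.ext fun v => by rw [← hG, hk, hG])

/-- The criterion `not_hasDiamond_of_action` for four operators satisfying the Weyl relations. -/
theorem not_hasDiamond_of_weyl_action {W : Type*} [Ring W] {ι₁ : Polynomial ℂ →+* W} {θ₁ : W}
    (hW : IsDiffOpRing (⇑(Polynomial.derivative (R := ℂ))) ι₁ θ₁)
    {S : Type*} [Ring S] {ι₂ : Polynomial W →+* S} {θ₂ : S}
    (hS : IsDiffOpRing (⇑(Polynomial.derivative (R := W))) ι₂ θ₂)
    {V : Type} [AddCommGroup V] [Module ℂ V] {a b x y : Module.End ℂ V}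
    (hba : b * a = a * b + 1) (hxa : Commute a x) (hxb : Commute b x) (hya : Commute a y)
    (hyb : Commute b y) (hyx : y * x = x * y + 1)
    {N : Submodule ℂ V} (hN : ∀ v ∈ N, x v ∈ N ∧ y v ∈ N ∧ a v ∈ N ∧ b v ∈ N) (hN0 : N ≠ ⊥)
    (hatom : ∀ U ≤ N, (∀ v ∈ U, x v ∈ U) → (∀ v ∈ U, y v ∈ U) → (∀ v ∈ U, a v ∈ U) →
      (∀ v ∈ U, b v ∈ U) → U ≠ ⊥ → N ≤ U)
    {w : V} (hw : ∀ U : Submodule ℂ V, (∀ v ∈ U, x v ∈ U) → (∀ v ∈ U, y v ∈ U) →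
      (∀ v ∈ U, a v ∈ U) → (∀ v ∈ U, b v ∈ U) → w ∈ U → U = ⊤)
    (hess : ∀ U : Submodule ℂ V, (∀ v ∈ U, x v ∈ U) → N ⊓ U = ⊥ → U = ⊥)
    {F : ℕ → Submodule ℂ V} (hF : ∀ k, ∀ v ∈ F k, x v ∈ F k ∧ y v ∈ F k ∧ a v ∈ F k ∧ b v ∈ F k)
    (hanti : Antitone F) (hne : ∀ k, F k ≠ F (k + 1)) : ¬ HasDiamond.{u} S := by
  obtain ⟨Φ, hΦ⟩ := exists_weyl_action hW hS hba hxa hxb hya hyb hyx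
  have stable {U : Submodule ℂ V} (h : ∀ v ∈ U, x v ∈ U ∧ y v ∈ U ∧ a v ∈ U ∧ b v ∈ U) :
      ∀ f ∈ ({a, b, x, y} : Set (Module.End ℂ V)), ∀ v ∈ U, f v ∈ U := by
    rintro f (rfl | rfl | rfl | rfl) v hv
    exacts [(h v hv).2.2.1, (h v hv).2.2.2, (h v hv).1, (h v hv).2.1]
  exact not_hasDiamond_of_action Φ hΦ (stable hN) hN0
    (fun U hUN hU =>
      hatom U hUN (hU x (by simp)) (hU y (by simp)) (hU a (by simp)) (hU b (by simp)))
    (fun U hU => hw U (hU x (by simp)) (hU y (by simp)) (hU a (by simp)) (hU b (by simp)))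
    (fun U hU => hess U (hU x (by simp))) (fun k => stable (hF k)) hanti hne

/-- The second Weyl algebra `A₂(ℂ) ≅ A₁(ℂ)[x][y; ∂/∂x]` does not satisfy property `(⋄)`:
here `W = A₁(ℂ) = ℂ[x][θ₁; ∂/∂x]` and `S = W[X][θ₂; ∂/∂X]`. -/
theorem second_weyl_not_hasDiamond
    (W : Type*) [Ring W] (ι₁ : Polynomial ℂ →+* W) (θ₁ : W)
    (hW : IsDiffOpRing (⇑(Polynomial.derivative (R := ℂ))) ι₁ θ₁)
    (S : Type*) [Ring S] (ι₂ : Polynomial W →+* S) (θ₂ : S)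
    (hS : IsDiffOpRing (⇑(Polynomial.derivative (R := W))) ι₂ θ₂) :
    ¬ HasDiamond S := by
  refine not_hasDiamond_of_weyl_action hW hS (V := ℂ[X][X][X] × ℂ[X][X][X]) (a := extY) (b := extDy)
    (x := extT) (y := extDt) (N := LinearMap.ker (LinearMap.snd ℂ _ _)) (w := (0, 1))
    (F := etaFiltration) extDy_mul_extY commute_extY_extT commute_extDy_extT
    commute_extY_extDt commute_extDy_extDt extDt_mul_extT ?_ ?_ ?_
    (fun U hT hDt hY hDy => ext_stable_eq_top hT hDt hY hDy) (fun U hT hU => ?_)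
    (fun k v hv => etaFiltration_stable k hv) ?_ fun k hk => ?_
  · rintro ⟨n, q⟩ hq
    obtain rfl : q = 0 := hq
    exact ⟨map_zero quotT, map_zero quotDt, map_zero quotY, map_zero quotDy⟩
  · exact (Submodule.ne_bot_iff _).2 ⟨(1, 0), rfl, fun h => one_ne_zero (congrArg Prod.fst h)⟩
  · intro U hUN hT hDt hY hDy hU
    have htop : U.comap (LinearMap.inl ℂ _ _) = ⊤ := by
      refine sym_stable_eq_top (fun p hp => ?_) (fun p hp => ?_) (fun p hp => ?_)
        (fun p hp => ?_) ?_
      · simpa [extT_apply] using hT _ hp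
      · simpa [extY_apply] using hY _ hp
      · simpa [extDt_apply] using hDt _ hp
      · simpa [extDy_apply] using hDy _ hp
      · obtain ⟨⟨n, q⟩, hv, hv0⟩ := (Submodule.ne_bot_iff _).1 hU
        obtain rfl : q = 0 := hUN hv
        exact (Submodule.ne_bot_iff _).2 ⟨n, hv, fun h => hv0 (by rw [h]; rfl)⟩
    rintro ⟨n, q⟩ hq
    obtain rfl : q = 0 := hq
    exact Submodule.eq_top_iff'.1 htop n
  · refine (Submodule.eq_bot_iff _).2 fun v => ext_stable_eq_zero hT fun w hw hw0 => ?_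
    exact (Submodule.eq_bot_iff _).1 hU w ⟨hw0, hw⟩
  · exact antitone_nat_of_succ_le fun k v hv => mem_etaFiltration.2
      ((pow_dvd_pow _ k.le_succ).trans (mem_etaFiltration.1 hv))
  · exact not_mem_etaFiltration_succ k (hk ▸ mem_etaFiltration.2 dvd_rfl)
end

section
/- Let R be a commutative Noetherian domain with derivation d and set S = R[θ; d]. Then S/Sθ is Artinian as a left S-module if and only if R is d-simple. -/
namespace IsDiffOpRing

section Ring

variable {R S : Type*} [Ring R] [Ring S] {d : R → R} {ι : R →+* S} {θ : S}

/-- The class of `ι a` in `S ⧸ Sθ`. -/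
def toQuotient (ι : R →+* S) (θ : S) (a : R) : S ⧸ (Submodule.span S {θ} : Submodule S S) :=
  Submodule.Quotient.mk (ι a)

theorem toQuotient_add (a b : R) :
    toQuotient ι θ (a + b) = toQuotient ι θ a + toQuotient ι θ b := by
  simp [toQuotient]

theorem smul_toQuotient (a b : R) : ι a • toQuotient ι θ b = toQuotient ι θ (a * b) := by
  simp [toQuotient, ← Submodule.Quotient.mk_smul]

theorem theta_smul_toQuotient (h : IsDiffOpRing d ι θ) (a : R) :
    θ • toQuotient ι θ a = toQuotient ι θ (d a) := by
  rw [toQuotient, toQuotient, ← Submodule.Quotient.mk_smul, Submodule.Quotient.eq,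
    smul_eq_mul, h.rel, add_sub_cancel_right]
  exact Submodule.smul_mem _ _ (Submodule.mem_span_singleton_self θ)

/-- An additive subgroup of a left `S`-module that is stable under `ι R` and `θ` is stable
under `S`. -/
theorem smul_mem {M : Type*} [AddCommGroup M] [Module S M] (h : IsDiffOpRing d ι θ)
    (N : AddSubgroup M) (hι : ∀ a, ∀ x ∈ N, ι a • x ∈ N) (hθ : ∀ x ∈ N, θ • x ∈ N)
    (s : S) {x : M} (hx : x ∈ N) : s • x ∈ N := by
  obtain ⟨p, rfl⟩ := h.basis.2 s
  have hpow (i : ℕ) : θ ^ i • x ∈ N := by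
    induction i with
    | zero => simpa using hx
    | succ i ih => rw [pow_succ', mul_smul]; exact hθ _ ih
  simp only [Polynomial.sum, Finset.sum_smul, mul_smul]
  exact N.sum_mem fun i _ => hι _ _ (hpow i)

theorem toQuotient_surjective (h : IsDiffOpRing d ι θ) :
    Function.Surjective (toQuotient ι θ) := by
  intro x
  obtain ⟨s, rfl⟩ := Submodule.Quotient.mk_surjective _ x
  let f : R →+ S ⧸ (Submodule.span S {θ} : Submodule S S) :=
    AddMonoidHom.mk' (toQuotient ι θ) toQuotient_add
  have := h.smul_mem f.range (x := toQuotient ι θ 1)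
    (by rintro a _ ⟨b, rfl⟩; exact ⟨a * b, (smul_toQuotient a b).symm⟩)
    (by rintro _ ⟨b, rfl⟩; exact ⟨d b, (h.theta_smul_toQuotient b).symm⟩) s ⟨1, rfl⟩
  rwa [toQuotient, map_one, ← Submodule.Quotient.mk_smul, smul_eq_mul, mul_one] at this

theorem eq_zero_of_toQuotient_eq_zero (h : IsDiffOpRing d ι θ) {a : R}
    (ha : toQuotient ι θ a = 0) : a = 0 := by
  rw [toQuotient, Submodule.Quotient.mk_eq_zero, Submodule.mem_span_singleton] at ha
  obtain ⟨s, hs⟩ := ha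
  obtain ⟨p, rfl⟩ := h.basis.2 s
  have hp : p * Polynomial.X = Polynomial.C a := by
    apply h.basis.1
    change (p * Polynomial.X).sum (fun i b => ι b * θ ^ i) =
      (Polynomial.C a).sum (fun i b => ι b * θ ^ i)
    rw [Polynomial.sum_C_index (by simp), pow_zero, mul_one, ← hs, smul_eq_mul]
    simp only [← Polynomial.eval₂_eq_sum, Polynomial.eval₂_mul_X]
  simpa using (congrArg (Polynomial.coeff · 0) hp).symm

theorem toQuotient_injective (h : IsDiffOpRing d ι θ) :
    Function.Injective (toQuotient ι θ) :=
  (injective_iff_map_eq_zero (AddMonoidHom.mk' (toQuotient ι θ) toQuotient_add)).2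
    fun _ => h.eq_zero_of_toQuotient_eq_zero

/-- The left ideal of those `a : R` whose class lies in a given submodule of `S ⧸ Sθ`. -/
def comapIdeal (ι : R →+* S) (θ : S)
    (N : Submodule S (S ⧸ (Submodule.span S {θ} : Submodule S S))) : Ideal R where
  carrier := {a | toQuotient ι θ a ∈ N}
  zero_mem' := by simp [toQuotient]
  add_mem' ha hb := by
    simp only [Set.mem_ofPred_eq, toQuotient_add] at *
    exact N.add_mem ha hb
  smul_mem' c a ha := by
    simp only [Set.mem_ofPred_eq, smul_eq_mul, ← smul_toQuotient] at *
    exact N.smul_mem _ ha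

theorem mem_comapIdeal {N : Submodule S (S ⧸ (Submodule.span S {θ} : Submodule S S))} {a : R} :
    a ∈ comapIdeal ι θ N ↔ toQuotient ι θ a ∈ N := Iff.rfl

/-- The image of a `d`-stable left ideal of `R` in `S ⧸ Sθ`. -/
def mapIdeal (h : IsDiffOpRing d ι θ) (I : Ideal R) (hI : ∀ a ∈ I, d a ∈ I) :
    Submodule S (S ⧸ (Submodule.span S {θ} : Submodule S S)) :=
  let N := I.toAddSubgroup.map (AddMonoidHom.mk' (toQuotient ι θ) toQuotient_add)
  { N with
    smul_mem' := fun s _ hx => h.smul_mem N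
      (by
        rintro a _ ⟨b, hb, rfl⟩
        exact ⟨a * b, I.mul_mem_left a hb, (smul_toQuotient a b).symm⟩)
      (by
        rintro _ ⟨b, hb, rfl⟩
        exact ⟨d b, hI b hb, (h.theta_smul_toQuotient b).symm⟩) s hx }

theorem toQuotient_mem_mapIdeal (h : IsDiffOpRing d ι θ) {I : Ideal R}
    {hI : ∀ a ∈ I, d a ∈ I} {a : R} : toQuotient ι θ a ∈ h.mapIdeal I hI ↔ a ∈ I := by
  constructor
  · rintro ⟨b, hb, hab⟩
    exact h.toQuotient_injective hab ▸ hb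
  · exact fun ha => ⟨a, ha, rfl⟩

theorem mapIdeal_le_mapIdeal (h : IsDiffOpRing d ι θ) {I J : Ideal R}
    (hI : ∀ a ∈ I, d a ∈ I) (hJ : ∀ a ∈ J, d a ∈ J) :
    h.mapIdeal I hI ≤ h.mapIdeal J hJ ↔ I ≤ J := by
  constructor
  · exact fun hle a ha => h.toQuotient_mem_mapIdeal.1 (hle (h.toQuotient_mem_mapIdeal.2 ha))
  · rintro hle _ ⟨a, ha, rfl⟩
    exact ⟨a, hle ha, rfl⟩

theorem isSimpleModule_quotient [Nontrivial R] (h : IsDiffOpRing d ι θ)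
    (hd : ∀ I : Ideal R, (∀ a ∈ I, d a ∈ I) → I = ⊥ ∨ I = ⊤) :
    IsSimpleModule S (S ⧸ (Submodule.span S {θ} : Submodule S S)) := by
  have : Nontrivial (S ⧸ (Submodule.span S {θ} : Submodule S S)) :=
    h.toQuotient_injective.nontrivial
  refine (isSimpleModule_iff _ _).2 { eq_bot_or_eq_top := fun N => ?_ }
  refine (hd (comapIdeal ι θ N) fun a ha => ?_).imp (fun hN => ?_) fun hN => ?_
  · rw [mem_comapIdeal, ← h.theta_smul_toQuotient]
    exact N.smul_mem θ ha
  · rw [eq_bot_iff]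
    intro x hx
    obtain ⟨a, rfl⟩ := h.toQuotient_surjective x
    rw [← mem_comapIdeal, hN, Ideal.mem_bot] at hx
    simp [hx, toQuotient]
  · rw [eq_top_iff]
    intro x _
    obtain ⟨a, rfl⟩ := h.toQuotient_surjective x
    rw [← mem_comapIdeal, hN]
    trivial

end Ring

end IsDiffOpRing

/-- Powers of a `d`-ideal are `d`-ideals. -/
theorem Derivation.apply_mem_pow {A R : Type*} [CommSemiring A] [CommSemiring R] [Algebra A R]
    (d : Derivation A R R) {I : Ideal R} (hI : ∀ a ∈ I, d a ∈ I) (n : ℕ) :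
    ∀ a ∈ I ^ n, d a ∈ I ^ n := by
  induction n with
  | zero => simp
  | succ n ih =>
    intro a ha
    rw [pow_succ] at ha ⊢
    induction ha using Submodule.mul_induction_on' with
    | mem_mul_mem x hx y hy =>
      rw [d.leibniz, smul_eq_mul, smul_eq_mul, mul_comm y]
      exact add_mem (Ideal.mul_mem_mul hx (hI y hy)) (Ideal.mul_mem_mul (ih x hx) hy)
    | add x _ y _ hx hy =>
      rw [map_add]
      exact add_mem hx hy

/-- A proper ideal of a Noetherian domain whose powers stabilize is zero. -/
theorem Ideal.eq_bot_of_pow_stabilizes {R : Type*} [CommRing R] [IsDomain R] [IsNoetherianRing R]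
    {I : Ideal R} (hI : I ≠ ⊤) {n : ℕ} (hn : ∀ m, n ≤ m → I ^ n ≤ I ^ m) : I = ⊥ := by
  have hbot : I ^ n = ⊥ := by
    rw [eq_bot_iff, ← Ideal.iInf_pow_eq_bot_of_isDomain I hI]
    refine le_iInf fun m => ?_
    rcases le_total n m with h | h
    · exact hn m h
    · exact Ideal.pow_le_pow_right h
  exact eq_zero_of_pow_eq_zero hbot

/-- For a commutative Noetherian domain `R` with derivation `d` and `S = R[θ; d]`,
`S/Sθ` is Artinian as a left `S`-module if and only if `R` is `d`-simple. -/
theorem quotient_theta_artinian_iff_dsimple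
    (R : Type*) [CommRing R] [IsDomain R] [IsNoetherianRing R]
    (d : Derivation ℤ R R)
    (S : Type*) [Ring S] (ι : R →+* S) (θ : S) (hS : IsDiffOpRing (⇑d) ι θ) :
    IsArtinian S (S ⧸ (Submodule.span S {θ} : Submodule S S)) ↔
      ∀ I : Ideal R, (∀ a ∈ I, d a ∈ I) → I = ⊥ ∨ I = ⊤ := by
  constructor
  · intro hA I hI
    refine or_iff_not_imp_right.2 fun hne => ?_
    obtain ⟨n, hn⟩ := IsArtinian.monotone_stabilizes
      (R := S) (M := S ⧸ (Submodule.span S {θ} : Submodule S S))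
      ⟨fun n => OrderDual.toDual (hS.mapIdeal (I ^ n) (d.apply_mem_pow hI n)),
        fun m n hmn => (hS.mapIdeal_le_mapIdeal (d.apply_mem_pow hI n)
          (d.apply_mem_pow hI m)).2 (Ideal.pow_le_pow_right hmn)⟩
    exact Ideal.eq_bot_of_pow_stabilizes hne fun m hm =>
      (hS.mapIdeal_le_mapIdeal (d.apply_mem_pow hI n) (d.apply_mem_pow hI m)).1
        (OrderDual.toDual.injective (hn m hm)).le
  · intro hd
    have := hS.isSimpleModule_quotient hd
    infer_instance
end

section
/- (Hart) Let R be a commutative ring with derivation d and S = R[θ; d]. Suppose 𝔪 is a maximal ideal of R that is not d-stable (i.e. d(𝔪) ⊄ 𝔪) and such that the residue field R/𝔪 has characteristic 0. Then S𝔪 is a maximal left ideal of S. -/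
/-- The set of sums of an element of `B` and of terms `θ ^ i * ι b` with `i < n`, `b ∈ I`. -/
def rightFiltration {R S : Type*} [CommRing R] [Ring S] (ι : R →+* S) (θ : S)
    (B : Submodule S S) (I : Ideal R) : ℕ → AddSubgroup S
  | 0 => B.toAddSubgroup
  | n + 1 => rightFiltration ι θ B I n ⊔
      I.toAddSubgroup.map ((AddMonoidHom.mulLeft (θ ^ n)).comp ι.toAddMonoidHom)

section rightFiltration

variable {R S : Type*} [CommRing R] [Ring S] {ι : R →+* S} {θ : S}
  {B : Submodule S S} {I : Ideal R}

theorem mem_rightFiltration_zero {s : S} : s ∈ rightFiltration ι θ B I 0 ↔ s ∈ B := Iff.rfl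

theorem mem_rightFiltration_succ {n : ℕ} {s : S} :
    s ∈ rightFiltration ι θ B I (n + 1) ↔
      ∃ f ∈ rightFiltration ι θ B I n, ∃ b ∈ I, f + θ ^ n * ι b = s := by
  simp [rightFiltration, AddSubgroup.mem_sup]

theorem rightFiltration_mono : Monotone (rightFiltration ι θ B I) :=
  monotone_nat_of_le_succ fun _ => le_sup_left

theorem le_rightFiltration {n : ℕ} {s : S} (hs : s ∈ B) : s ∈ rightFiltration ι θ B I n :=
  rightFiltration_mono (Nat.zero_le n) hs

theorem pow_mul_mem_rightFiltration {n : ℕ} {b : R} (hb : b ∈ I) :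
    θ ^ n * ι b ∈ rightFiltration ι θ B I (n + 1) :=
  mem_rightFiltration_succ.2 ⟨0, zero_mem _, b, hb, zero_add _⟩

theorem mul_mem_rightFiltration_succ {n : ℕ} {s : S} (hs : s ∈ rightFiltration ι θ B I n) :
    θ * s ∈ rightFiltration ι θ B I (n + 1) := by
  induction n generalizing s with
  | zero => exact le_rightFiltration (B.smul_mem θ hs)
  | succ n ih =>
    obtain ⟨f, hf, b, hb, rfl⟩ := mem_rightFiltration_succ.1 hs
    rw [mul_add, ← mul_assoc, ← pow_succ']
    exact add_mem (rightFiltration_mono (Nat.le_succ _) (ih hf)) (pow_mul_mem_rightFiltration hb)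

theorem pow_mul_mem_rightFiltration_add {n : ℕ} (i : ℕ) {s : S}
    (hs : s ∈ rightFiltration ι θ B I n) : θ ^ i * s ∈ rightFiltration ι θ B I (n + i) := by
  induction i with
  | zero => simpa using hs
  | succ i ih =>
    rw [pow_succ', mul_assoc, ← add_assoc]
    exact mul_mem_rightFiltration_succ ih

variable {d : R → R}

theorem coeff_mul_pow_mul_sub_mem_rightFiltration (rel : ∀ a, θ * ι a = ι a * θ + ι (d a))
    (n : ℕ) (a : R) {b : R} (hb : b ∈ I) :
    ι a * (θ ^ n * ι b) - θ ^ n * ι (a * b) ∈ rightFiltration ι θ B I n := by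
  induction n generalizing a with
  | zero => simp
  | succ n ih =>
    have h : ι a * (θ ^ (n + 1) * ι b) - θ ^ (n + 1) * ι (a * b) =
        θ * (ι a * (θ ^ n * ι b) - θ ^ n * ι (a * b))
          - (ι (d a) * (θ ^ n * ι b) - θ ^ n * ι (d a * b)) - θ ^ n * ι (d a * b) := by
      have e : ι a * θ = θ * ι a - ι (d a) := by rw [rel]; abel
      rw [pow_succ', mul_assoc θ, ← mul_assoc (ι a) θ, e]
      noncomm_ring
    rw [h]
    exact sub_mem (sub_mem (mul_mem_rightFiltration_succ (ih a))
      (rightFiltration_mono (Nat.le_succ _) (ih (d a))))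
      (pow_mul_mem_rightFiltration (I.mul_mem_left _ hb))

theorem coeff_mul_mem_rightFiltration (rel : ∀ a, θ * ι a = ι a * θ + ι (d a))
    {n : ℕ} (a : R) {s : S} (hs : s ∈ rightFiltration ι θ B I n) :
    ι a * s ∈ rightFiltration ι θ B I n := by
  induction n generalizing s with
  | zero => exact B.smul_mem (ι a) hs
  | succ n ih =>
    obtain ⟨f, hf, b, hb, rfl⟩ := mem_rightFiltration_succ.1 hs
    have h := add_mem (rightFiltration_mono (Nat.le_succ n)
      (coeff_mul_pow_mul_sub_mem_rightFiltration (B := B) rel n a hb))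
      (pow_mul_mem_rightFiltration (I.mul_mem_left a hb))
    rw [sub_add_cancel] at h
    rw [mul_add]
    exact add_mem (rightFiltration_mono (Nat.le_succ n) (ih hf)) h

theorem coeff_mul_pow_succ_mul_add_mem_rightFiltration
    (rel : ∀ a, θ * ι a = ι a * θ + ι (d a)) {c : R} (n : ℕ) {b : R}
    (hcb : ι (c * b) ∈ B) (hb : b ∈ I) :
    ι c * (θ ^ (n + 1) * ι b) + θ ^ n * ι ((n + 1 : ℕ) * (d c * b)) ∈
      rightFiltration ι θ B I n := by
  have e : ι c * θ = θ * ι c - ι (d c) := by rw [rel]; abel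
  induction n with
  | zero =>
    have h : ι c * (θ ^ (0 + 1) * ι b) + θ ^ 0 * ι ((0 + 1 : ℕ) * (d c * b)) =
        θ * ι (c * b) := by
      rw [zero_add, pow_one, ← mul_assoc, e]
      simp [sub_mul, mul_assoc]
    rw [h]
    exact B.smul_mem θ hcb
  | succ n ih =>
    have h : ι c * (θ ^ (n + 1 + 1) * ι b) + θ ^ (n + 1) * ι ((n + 1 + 1 : ℕ) * (d c * b)) =
        θ * (ι c * (θ ^ (n + 1) * ι b) + θ ^ n * ι ((n + 1 : ℕ) * (d c * b)))
          - (ι (d c) * (θ ^ (n + 1) * ι b) - θ ^ (n + 1) * ι (d c * b)) := by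
      rw [pow_succ' θ (n + 1), mul_assoc θ, ← mul_assoc (ι c) θ, e,
        Nat.cast_add (n + 1) 1, Nat.cast_one, add_mul, one_mul, map_add, mul_add, mul_add,
        ← mul_assoc θ (θ ^ n), ← pow_succ', sub_mul, mul_assoc θ (ι c)]
      abel
    rw [h]
    exact sub_mem (mul_mem_rightFiltration_succ ih)
      (coeff_mul_pow_mul_sub_mem_rightFiltration rel (n + 1) (d c) hb)

theorem coeff_mul_mem_rightFiltration_of_succ (rel : ∀ a, θ * ι a = ι a * θ + ι (d a))
    {c : R} (hc : ∀ b, ι (c * b) ∈ B) {n : ℕ} {s : S}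
    (hs : s ∈ rightFiltration ι θ B I (n + 1)) : ι c * s ∈ rightFiltration ι θ B I n := by
  obtain ⟨f, hf, b, hb, rfl⟩ := mem_rightFiltration_succ.1 hs
  have h := add_mem (coeff_mul_pow_mul_sub_mem_rightFiltration (B := B) rel n c hb)
    (le_rightFiltration (B.smul_mem (θ ^ n) (hc b)))
  rw [smul_eq_mul, sub_add_cancel] at h
  rw [mul_add]
  exact add_mem (coeff_mul_mem_rightFiltration rel c hf) h

theorem exists_mul_eval₂_eq (rel : ∀ a, θ * ι a = ι a * θ + ι (d a)) {n : ℕ}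
    {p : Polynomial R} (hp : p.degree < n) :
    ∃ q : Polynomial R, q.degree < n ∧ θ * p.eval₂ ι θ = (p * .X + q).eval₂ ι θ := by
  refine ⟨∑ i ∈ Finset.range n, .monomial i (d (p.coeff i)), ?_, ?_⟩
  · rw [← Polynomial.mem_degreeLT]
    refine sum_mem fun i hi => ?_
    rw [Polynomial.mem_degreeLT]
    exact (Polynomial.degree_monomial_le _ _).trans_lt (by exact_mod_cast Finset.mem_range.1 hi)
  · have hsum : p.eval₂ ι θ = ∑ i ∈ Finset.range n, ι (p.coeff i) * θ ^ i := by
      rcases eq_or_ne p 0 with rfl | h0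
      · simp
      · exact Polynomial.eval₂_eq_sum_range' ι ((Polynomial.natDegree_lt_iff_degree_lt h0).2 hp) θ
    rw [Polynomial.eval₂_add, Polynomial.eval₂_mul_X, Polynomial.eval₂_finsetSum, hsum,
      Finset.mul_sum, Finset.sum_mul, ← Finset.sum_add_distrib]
    refine Finset.sum_congr rfl fun i _ => ?_
    rw [Polynomial.eval₂_monomial, ← mul_assoc, rel, add_mul, mul_assoc, mul_assoc, ← pow_succ,
      ← pow_succ']

/-- Modulo terms of lower degree, `θ ^ n * ι b` and `ι b * θ ^ n` agree. -/
theorem exists_pow_mul_eq_eval₂ (rel : ∀ a, θ * ι a = ι a * θ + ι (d a)) (n : ℕ) (b : R) :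
    ∃ q : Polynomial R, q.degree < n ∧ θ ^ n * ι b = (.monomial n b + q).eval₂ ι θ := by
  induction n with
  | zero => exact ⟨0, by simp, by simp⟩
  | succ n ih =>
    obtain ⟨q, hq, h⟩ := ih
    have hlt : (Polynomial.monomial n b + q).degree < (n + 1 : ℕ) :=
      (Polynomial.degree_add_le _ _).trans_lt (max_lt
        ((Polynomial.degree_monomial_le _ _).trans_lt (by exact_mod_cast Nat.lt_succ_self n))
        (hq.trans (by exact_mod_cast Nat.lt_succ_self n)))
    obtain ⟨r, hr, h'⟩ := exists_mul_eval₂_eq rel hlt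
    refine ⟨q * .X + r, (Polynomial.degree_add_le _ _).trans_lt (max_lt ?_ hr), ?_⟩
    · rcases eq_or_ne q 0 with rfl | h0
      · simp
      · have := (Polynomial.natDegree_lt_iff_degree_lt h0).2 hq
        exact (Polynomial.degree_le_natDegree.trans (Nat.cast_le.2
          (Polynomial.natDegree_mul_le.trans (Nat.add_le_add_left Polynomial.natDegree_X_le _)))
            ).trans_lt (by exact_mod_cast Nat.succ_lt_succ this)
    · rw [pow_succ', mul_assoc, h, h', add_mul, Polynomial.monomial_mul_X, add_assoc]

theorem exists_eq_eval₂_of_mem_rightFiltration (rel : ∀ a, θ * ι a = ι a * θ + ι (d a))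
    {n : ℕ} {s : S} (hs : s ∈ rightFiltration ι θ ⊥ I n) :
    ∃ q : Polynomial R, q.degree < n ∧ s = q.eval₂ ι θ := by
  induction n generalizing s with
  | zero =>
    have h0 : s = 0 := mem_rightFiltration_zero.1 hs
    exact ⟨0, by simp, by simp [h0]⟩
  | succ n ih =>
    obtain ⟨f, hf, b, -, rfl⟩ := mem_rightFiltration_succ.1 hs
    obtain ⟨p, hp, rfl⟩ := ih hf
    obtain ⟨q, hq, h⟩ := exists_pow_mul_eq_eval₂ rel n b
    have hn : (n : WithBot ℕ) < (n + 1 : ℕ) := by exact_mod_cast Nat.lt_succ_self n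
    refine ⟨p + (.monomial n b + q), ?_, by rw [h, Polynomial.eval₂_add _ _ (p := p)]⟩
    exact (Polynomial.degree_add_le _ _).trans_lt (max_lt (hp.trans hn)
      ((Polynomial.degree_add_le _ _).trans_lt (max_lt
        ((Polynomial.degree_monomial_le _ _).trans_lt hn) (hq.trans hn))))

theorem one_notMem_rightFiltration_bot (rel : ∀ a, θ * ι a = ι a * θ + ι (d a))
    (inj : Function.Injective fun p : Polynomial R => p.eval₂ ι θ) (hI : I ≠ ⊤) (n : ℕ) :
    (1 : S) ∉ rightFiltration ι θ ⊥ I n := by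
  have h1 : (1 : R) ∉ I := (Ideal.ne_top_iff_one I).1 hI
  have hι : Function.Injective ι := fun a b h =>
    Polynomial.C_injective (inj (by simpa using h))
  induction n with
  | zero =>
    intro h
    have h0 : (1 : S) = 0 := mem_rightFiltration_zero.1 h
    exact h1 (hι (a₁ := 1) (a₂ := 0) (by simpa using h0) ▸ I.zero_mem)
  | succ n ih =>
    intro h
    obtain ⟨f, hf, b, hb, hfb⟩ := mem_rightFiltration_succ.1 h
    obtain ⟨p, hp, rfl⟩ := exists_eq_eval₂_of_mem_rightFiltration rel hf
    obtain ⟨q, hq, hqb⟩ := exists_pow_mul_eq_eval₂ rel n b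
    have hpoly : p + (.monomial n b + q) = 1 := inj (by
      simp only [Polynomial.eval₂_one]
      rw [Polynomial.eval₂_add, ← hqb, hfb])
    have hcoeff := congrArg (fun r => Polynomial.coeff r n) hpoly
    simp only [Polynomial.coeff_add, Polynomial.coeff_eq_zero_of_degree_lt hp,
      Polynomial.coeff_eq_zero_of_degree_lt hq, Polynomial.coeff_monomial_same, zero_add,
      add_zero, Polynomial.coeff_one] at hcoeff
    split_ifs at hcoeff with hn
    · exact h1 (hcoeff ▸ hb)
    · rw [hcoeff, map_zero, mul_zero, add_zero] at hfb
      exact ih (hfb ▸ hf)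

theorem exists_mul_mem_rightFiltration (rel : ∀ a, θ * ι a = ι a * θ + ι (d a))
    (surj : Function.Surjective fun p : Polynomial R => p.eval₂ ι θ) (s : S) {n : ℕ} {x : S}
    (hx : x ∈ rightFiltration ι θ B I n) : ∃ k, s * x ∈ rightFiltration ι θ B I k := by
  obtain ⟨p, rfl⟩ := surj s
  induction p using Polynomial.induction_on' with
  | add p q hp hq =>
    obtain ⟨k, hk⟩ := hp
    obtain ⟨l, hl⟩ := hq
    refine ⟨max k l, ?_⟩
    simp only [Polynomial.eval₂_add, add_mul]
    exact add_mem (rightFiltration_mono (le_max_left k l) hk)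
      (rightFiltration_mono (le_max_right k l) hl)
  | monomial i a =>
    refine ⟨n + i, ?_⟩
    simp only [Polynomial.eval₂_monomial, mul_assoc]
    exact coeff_mul_mem_rightFiltration rel a (pow_mul_mem_rightFiltration_add i hx)

theorem exists_mem_rightFiltration_of_mem_span (rel : ∀ a, θ * ι a = ι a * θ + ι (d a))
    (surj : Function.Surjective fun p : Polynomial R => p.eval₂ ι θ) {s : S}
    (hs : s ∈ Submodule.span S (ι '' (I : Set R))) :
    ∃ k, s ∈ rightFiltration ι θ B I k := by
  induction hs using Submodule.span_induction with
  | mem x hx =>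
    obtain ⟨b, hb, rfl⟩ := hx
    exact ⟨1, by simpa using pow_mul_mem_rightFiltration (θ := θ) (B := B) (n := 0) hb⟩
  | zero => exact ⟨0, zero_mem _⟩
  | add x y _ _ hx hy =>
    obtain ⟨k, hk⟩ := hx
    obtain ⟨l, hl⟩ := hy
    exact ⟨max k l, add_mem (rightFiltration_mono (le_max_left k l) hk)
      (rightFiltration_mono (le_max_right k l) hl)⟩
  | smul a x _ hx =>
    obtain ⟨k, hk⟩ := hx
    exact exists_mul_mem_rightFiltration rel surj a hk

theorem span_image_ne_top (rel : ∀ a, θ * ι a = ι a * θ + ι (d a))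
    (bij : Function.Bijective fun p : Polynomial R => p.eval₂ ι θ) (hI : I ≠ ⊤) :
    Submodule.span S (ι '' (I : Set R)) ≠ ⊤ := by
  intro h
  obtain ⟨k, hk⟩ := exists_mem_rightFiltration_of_mem_span (B := ⊥) (I := I) rel bij.2
    (s := 1) (h ▸ Submodule.mem_top)
  exact one_notMem_rightFiltration_bot rel bij.1 hI k hk

/-- A left ideal containing `ι '' m` and an element of leading term `θ ^ n * ι b` with `b ∉ m`
is everything: multiplying by `c ∈ m` with `d c ∉ m` lowers the degree. -/
theorem one_mem_of_add_pow_mul_mem (rel : ∀ a, θ * ι a = ι a * θ + ι (d a)) {m : Ideal R}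
    (hm : m.IsMaximal) [CharZero (R ⧸ m)] {c : R} (hc : c ∈ m) (hdc : d c ∉ m)
    {N : Submodule S S} (hB : ∀ a ∈ m, ι a ∈ B) (hBN : B ≤ N) {n : ℕ} {f : S} {b : R}
    (hf : f ∈ rightFiltration ι θ B ⊤ n) (hb : b ∉ m) (hN : f + θ ^ n * ι b ∈ N) :
    (1 : S) ∈ N := by
  induction n generalizing f b with
  | zero =>
    have hbN : ι b ∈ N := by
      simpa using sub_mem hN (hBN (mem_rightFiltration_zero.1 hf))
    obtain ⟨r, a, ha, hr⟩ := hm.exists_inv hb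
    rw [← map_one ι, ← hr, map_add, map_mul]
    exact add_mem (N.smul_mem (ι r) hbN) (hBN (hB a ha))
  | succ n ih =>
    have hcB : ∀ b, ι (c * b) ∈ B := fun b => hB _ (m.mul_mem_right b hc)
    have hlow := add_mem (coeff_mul_mem_rightFiltration_of_succ rel hcB hf)
      (coeff_mul_pow_succ_mul_add_mem_rightFiltration (I := ⊤) rel n (hcB b) trivial)
    have hprime := hm.isPrime
    have hn : ((n + 1 : ℕ) : R) ∉ m := by
      rw [← Ideal.Quotient.eq_zero_iff_mem, map_natCast]
      exact Nat.cast_ne_zero.2 n.succ_ne_zero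
    refine ih (b := -((n + 1 : ℕ) * (d c * b))) hlow ?_ ?_
    · rw [neg_mem_iff]
      exact hprime.mul_notMem hn (hprime.mul_notMem hdc hb)
    · rw [map_neg, mul_neg, ← add_assoc, add_neg_cancel_right, ← mul_add]
      exact N.smul_mem (ι c) hN

theorem one_mem_of_mem_rightFiltration (rel : ∀ a, θ * ι a = ι a * θ + ι (d a)) {m : Ideal R}
    (hm : m.IsMaximal) [CharZero (R ⧸ m)] {c : R} (hc : c ∈ m) (hdc : d c ∉ m)
    {N : Submodule S S} (hB : ∀ a ∈ m, ι a ∈ B) (hBN : B ≤ N) {n : ℕ} {s : S}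
    (hs : s ∈ rightFiltration ι θ B ⊤ n) (hsN : s ∈ N) (hsB : s ∉ B) : (1 : S) ∈ N := by
  induction n generalizing s with
  | zero => exact absurd (mem_rightFiltration_zero.1 hs) hsB
  | succ n ih =>
    obtain ⟨f, hf, b, -, rfl⟩ := mem_rightFiltration_succ.1 hs
    by_cases hb : b ∈ m
    · have hbB : θ ^ n * ι b ∈ B := B.smul_mem (θ ^ n) (hB b hb)
      exact ih (add_mem hf (le_rightFiltration hbB)) hsN hsB
    · exact one_mem_of_add_pow_mul_mem rel hm hc hdc hB hBN hf hb hsN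

end rightFiltration

/-- (Hart) Let `R` be a commutative ring with derivation `d` and `S = R[θ; d]`.  If `𝔪`
is a maximal ideal of `R` that is not `d`-stable and `R/𝔪` has characteristic `0`, then
`S𝔪` is a maximal left ideal of `S` (a coatom in the lattice of left ideals). -/
theorem hart_maximal_left_ideal
    (R : Type*) [CommRing R] (d : Derivation ℤ R R)
    (S : Type*) [Ring S] (ι : R →+* S) (θ : S) (hS : IsDiffOpRing (⇑d) ι θ)
    (m : Ideal R) (hmax : m.IsMaximal)
    (hnotstable : ¬ ∀ a ∈ m, d a ∈ m)
    (hchar : CharZero (R ⧸ m)) :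
    IsCoatom (Submodule.span S (ι '' (m : Set R)) : Submodule S S) := by
  obtain ⟨c, hc, hdc⟩ : ∃ c ∈ m, d c ∉ m := by simpa using hnotstable
  have bij : Function.Bijective fun p : Polynomial R => p.eval₂ ι θ := by
    simpa only [Polynomial.eval₂_eq_sum] using hS.basis
  refine ⟨span_image_ne_top hS.rel bij hmax.ne_top, fun N hN => ?_⟩
  obtain ⟨hle, s, hsN, hs⟩ := SetLike.lt_iff_le_and_exists.1 hN
  have hone : (1 : S) ∈ rightFiltration ι θ (Submodule.span S (ι '' (m : Set R))) ⊤ 1 := by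
    simpa using pow_mul_mem_rightFiltration (ι := ι) (θ := θ) (n := 0)
      (B := Submodule.span S (ι '' (m : Set R))) (Submodule.mem_top (x := (1 : R)))
  obtain ⟨k, hk⟩ := exists_mul_mem_rightFiltration hS.rel bij.2 s hone
  rw [mul_one] at hk
  exact (Ideal.eq_top_iff_one N).2 (one_mem_of_mem_rightFiltration hS.rel hmax hc hdc
    (fun a ha => Submodule.subset_span (Set.mem_image_of_mem ι ha)) hle hk hsN hs)
end

section
/- Let R be a commutative ring with derivation d and set S = R[θ; d]. If 𝔭 is a prime ideal of R that does not contain any non-zero d-ideal of R, then Sθ/I is an essential left S-submodule of S/I, where I = S𝔭θ. -/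
section DiffOp

open Polynomial

variable {R : Type*} [CommRing R] (d : Derivation ℤ R R)

/-- Left multiplication by `θ` on `R[θ; d]`, in terms of left coefficients. -/
noncomputable def thetaMul : R[X] →+ R[X] where
  toFun Q := X * Q + Q.sum fun n a => monomial n (d a)
  map_zero' := by simp
  map_add' P Q := by
    rw [sum_add_index P Q _ (by simp) (by simp)]
    ring

theorem thetaMul_apply (Q : R[X]) :
    thetaMul d Q = X * Q + Q.sum fun n a => monomial n (d a) := rfl

theorem thetaMul_monomial (n : ℕ) (a : R) :
    thetaMul d (monomial n a) = monomial (n + 1) a + monomial n (d a) := by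
  rw [thetaMul_apply, sum_monomial_index _ _ (by simp), X_mul_monomial]

theorem coeff_thetaMul_succ (Q : R[X]) (n : ℕ) :
    (thetaMul d Q).coeff (n + 1) = Q.coeff n + d (Q.coeff (n + 1)) := by
  induction Q using Polynomial.induction_on' with
  | add P Q hP hQ => simp only [map_add, coeff_add, hP, hQ]; ring
  | monomial m a =>
    simp only [thetaMul_monomial, coeff_add, coeff_monomial, Nat.add_right_cancel_iff]
    split_ifs <;> simp

theorem thetaMul_C_mul (a : R) (Q : R[X]) :
    thetaMul d (C a * Q) = C a * thetaMul d Q + C (d a) * Q := by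
  induction Q using Polynomial.induction_on' with
  | add P Q hP hQ => simp only [mul_add, map_add, hP, hQ]; ring
  | monomial m b =>
    simp only [thetaMul_monomial, C_mul_monomial, mul_add, Derivation.leibniz, smul_eq_mul,
      map_add, mul_comm b, add_assoc]

theorem natDegree_thetaMul_le {Q : R[X]} {n : ℕ} (h : Q.natDegree ≤ n) :
    (thetaMul d Q).natDegree ≤ n + 1 := by
  rw [natDegree_le_iff_coeff_eq_zero]
  intro N hN
  obtain ⟨k, rfl⟩ : ∃ k, N = k + 1 := ⟨N - 1, by omega⟩
  rw [coeff_thetaMul_succ, coeff_eq_zero_of_natDegree_lt (by omega),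
    coeff_eq_zero_of_natDegree_lt (by omega), map_zero, add_zero]

theorem natDegree_thetaMul_iterate_C_le (k : ℕ) (a : R) :
    ((thetaMul d)^[k] (C a)).natDegree ≤ k := by
  induction k with
  | zero => simp
  | succ k ih =>
    rw [Function.iterate_succ_apply']
    exact natDegree_thetaMul_le d ih

theorem coeff_thetaMul_iterate_C (k : ℕ) (a : R) : ((thetaMul d)^[k] (C a)).coeff k = a := by
  induction k with
  | zero => simp
  | succ k ih =>
    rw [Function.iterate_succ_apply', coeff_thetaMul_succ, ih, coeff_eq_zero_of_natDegree_lt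
      ((natDegree_thetaMul_iterate_C_le d k a).trans_lt k.lt_succ_self), map_zero, add_zero]

/-- The left coefficients of `∑ θ^k a_k`, where `a_k` are the coefficients of `P`. -/
noncomputable def ofRightCoeffs : R[X] →+ R[X] where
  toFun P := P.sum fun k a => (thetaMul d)^[k] (C a)
  map_zero' := by simp
  map_add' P Q := sum_add_index P Q _ (by simp) (by simp)

theorem ofRightCoeffs_apply (P : R[X]) :
    ofRightCoeffs d P = P.sum fun k a => (thetaMul d)^[k] (C a) := rfl

theorem ofRightCoeffs_monomial (k : ℕ) (a : R) :
    ofRightCoeffs d (monomial k a) = (thetaMul d)^[k] (C a) := by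
  rw [ofRightCoeffs_apply, sum_monomial_index _ _ (by simp)]

theorem ofRightCoeffs_X_mul (P : R[X]) :
    ofRightCoeffs d (X * P) = thetaMul d (ofRightCoeffs d P) := by
  induction P using Polynomial.induction_on' with
  | add P Q hP hQ => simp only [mul_add, map_add, hP, hQ]
  | monomial m a =>
    rw [X_mul_monomial, ofRightCoeffs_monomial, ofRightCoeffs_monomial,
      Function.iterate_succ_apply']

theorem coeff_ofRightCoeffs {P : R[X]} {m : ℕ} (h : P.natDegree ≤ m) :
    (ofRightCoeffs d P).coeff m = P.coeff m := by
  rw [ofRightCoeffs_apply, sum_over_range' P (by simp) (m + 1) (by omega), finsetSum_coeff,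
    Finset.sum_range_succ, coeff_thetaMul_iterate_C, Finset.sum_eq_zero, zero_add]
  intro k hk
  exact coeff_eq_zero_of_natDegree_lt
    ((natDegree_thetaMul_iterate_C_le d k _).trans_lt (Finset.mem_range.mp hk))

/-- The left ideal `S𝔭` of `S = R[θ; d]`, in terms of left coefficients. -/
noncomputable def leftIdealSpan (p : Ideal R) : AddSubgroup R[X] :=
  (Submodule.toAddSubgroup (p.map (C : R →+* R[X]))).map (ofRightCoeffs d)

variable {d} {p : Ideal R}

theorem mem_leftIdealSpan {Q : R[X]} :
    Q ∈ leftIdealSpan d p ↔ ∃ P : R[X], (∀ n, P.coeff n ∈ p) ∧ ofRightCoeffs d P = Q := by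
  simp only [leftIdealSpan, AddSubgroup.mem_map, Submodule.mem_toAddSubgroup,
    Ideal.mem_map_C_iff]

theorem thetaMul_iterate_C_mem (k : ℕ) {a : R} (ha : a ∈ p) :
    (thetaMul d)^[k] (C a) ∈ leftIdealSpan d p := by
  refine mem_leftIdealSpan.mpr ⟨monomial k a, fun n => ?_, ofRightCoeffs_monomial d k a⟩
  rw [coeff_monomial]
  split_ifs
  exacts [ha, p.zero_mem]

theorem leftIdealSpan_induction {A : AddSubgroup R[X]}
    (h : ∀ k, ∀ a ∈ p, (thetaMul d)^[k] (C a) ∈ A) : leftIdealSpan d p ≤ A := by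
  intro Q hQ
  obtain ⟨P, hP, rfl⟩ := mem_leftIdealSpan.mp hQ
  exact A.sum_mem fun k _ => h k _ (hP k)

theorem thetaMul_mem {Q : R[X]} (hQ : Q ∈ leftIdealSpan d p) :
    thetaMul d Q ∈ leftIdealSpan d p := by
  refine leftIdealSpan_induction (A := (leftIdealSpan d p).comap (thetaMul d)) ?_ hQ
  intro k a ha
  rw [AddSubgroup.mem_comap, ← Function.iterate_succ_apply' (thetaMul d)]
  exact thetaMul_iterate_C_mem (k + 1) ha

theorem C_mul_mem {Q : R[X]} (a : R) (hQ : Q ∈ leftIdealSpan d p) :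
    C a * Q ∈ leftIdealSpan d p := by
  refine leftIdealSpan_induction
    (A := (leftIdealSpan d p).comap (AddMonoidHom.mulLeft (C a))) ?_ hQ
  intro k b hb
  simp only [AddSubgroup.mem_comap, AddMonoidHom.coe_mulLeft]
  induction k generalizing a with
  | zero =>
    rw [Function.iterate_zero_apply, ← C_mul]
    exact thetaMul_iterate_C_mem 0 (p.mul_mem_left a hb)
  | succ k ih =>
    rw [Function.iterate_succ_apply', ← add_sub_cancel_right (C a * _) (C (d a) * _),
      ← thetaMul_C_mul]
    exact sub_mem (thetaMul_mem (ih a)) (ih (d a))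

theorem coeff_mem_of_mem_leftIdealSpan {Q : R[X]} {m : ℕ} (hQ : Q ∈ leftIdealSpan d p)
    (h : Q.natDegree ≤ m) : Q.coeff m ∈ p := by
  obtain ⟨P, hP, rfl⟩ := mem_leftIdealSpan.mp hQ
  by_cases h0 : P = 0
  · simp [h0]
  · have h1 : P.natDegree ≤ (ofRightCoeffs d P).natDegree := by
      apply le_natDegree_of_ne_zero
      rw [coeff_ofRightCoeffs d le_rfl]
      exact leadingCoeff_ne_zero.mpr h0
    rw [coeff_ofRightCoeffs d (h1.trans h)]
    exact hP m

variable (d p) in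
theorem exists_sub_mem_leftIdealSpan (Q : R[X]) :
    ∃ Q₀, Q - Q₀ ∈ leftIdealSpan d p ∧ (Q₀ = 0 ∨ Q₀.leadingCoeff ∉ p) := by
  induction h : Q.degree using WellFoundedLT.induction generalizing Q with
  | ind n ih =>
    by_cases h0 : Q = 0
    · exact ⟨0, by simp [h0, zero_mem], Or.inl rfl⟩
    by_cases hp : Q.leadingCoeff ∈ p
    · set Q₁ := (thetaMul d)^[Q.natDegree] (C Q.leadingCoeff) with hQ₁
      have hlt : (Q - Q₁).degree < n := by
        rw [← h, degree_eq_natDegree h0, degree_lt_iff_coeff_zero]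
        intro m hm
        rcases hm.eq_or_lt with rfl | hm
        · rw [coeff_sub, hQ₁, coeff_thetaMul_iterate_C, coeff_natDegree, sub_self]
        · rw [coeff_sub, coeff_eq_zero_of_natDegree_lt hm, coeff_eq_zero_of_natDegree_lt
            ((natDegree_thetaMul_iterate_C_le d _ _).trans_lt hm), sub_self]
      obtain ⟨Q₀, hmem, hQ₀⟩ := ih _ hlt _ rfl
      refine ⟨Q₀, ?_, hQ₀⟩
      have := add_mem hmem (thetaMul_iterate_C_mem (d := d) Q.natDegree hp)
      rwa [← hQ₁, sub_right_comm, sub_add_cancel] at this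
    · exact ⟨Q, by simp [zero_mem], Or.inr hp⟩

/-- For `r ∉ 𝔭` and `f = rθ - d(r)`, no `Q ∈ S` reduced modulo `S𝔭` has
`r² + f Q ∈ S𝔭`. -/
theorem C_sq_add_notMem_leftIdealSpan (hp : p.IsPrime) {r : R} (hr : r ∉ p) {Q : R[X]}
    (hQ : Q = 0 ∨ Q.leadingCoeff ∉ p) :
    C (r * r) + (C r * thetaMul d Q - C (d r) * Q) ∉ leftIdealSpan d p := by
  intro hmem
  rcases hQ with rfl | hQ
  · have := coeff_mem_of_mem_leftIdealSpan hmem (m := 0) (by simp [-map_mul])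
    simp only [map_zero, mul_zero, sub_zero, add_zero, coeff_C_zero] at this
    exact (hp.mem_or_mem this).elim hr hr
  · have hdeg : (C (r * r) + (C r * thetaMul d Q - C (d r) * Q)).natDegree ≤
        Q.natDegree + 1 := by
      refine natDegree_add_le_of_degree_le (by simp [-map_mul])
        ((natDegree_sub_le _ _).trans (max_le ?_ ?_))
      · exact (natDegree_C_mul_le _ _).trans (natDegree_thetaMul_le d le_rfl)
      · exact (natDegree_C_mul_le _ _).trans (Nat.le_succ _)
    have := coeff_mem_of_mem_leftIdealSpan hmem hdeg
    simp only [coeff_add, coeff_sub, coeff_C_mul, coeff_C_succ, coeff_thetaMul_succ,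
      coeff_eq_zero_of_natDegree_lt Q.natDegree.lt_succ_self, map_zero, add_zero, mul_zero,
      sub_zero, zero_add] at this
    exact (hp.mem_or_mem this).elim hr hQ

variable {S : Type*} [Ring S] {ι : R →+* S} {θ : S}

theorem eval₂_C_mul_noncomm (a : R) (Q : R[X]) : eval₂ ι θ (C a * Q) = ι a * eval₂ ι θ Q := by
  induction Q using Polynomial.induction_on' with
  | add P Q hP hQ => simp only [mul_add, eval₂_add, hP, hQ]
  | monomial m b => rw [C_mul_monomial, eval₂_monomial, eval₂_monomial, map_mul, mul_assoc]

/-- The ideal of constant terms `r` of the elements `r + Qθ` of a left ideal of `S`. -/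
def constantTerms (ι : R →+* S) (θ : S) (V : Submodule S S) : Ideal R where
  carrier := {r | ∃ Q : R[X], ι r + eval₂ ι θ Q * θ ∈ V}
  zero_mem' := ⟨0, by simp⟩
  add_mem' := by
    rintro a b ⟨P, hP⟩ ⟨Q, hQ⟩
    refine ⟨P + Q, ?_⟩
    have := V.add_mem hP hQ
    rwa [add_add_add_comm, ← map_add, ← add_mul, ← eval₂_add] at this
  smul_mem' := by
    rintro a b ⟨Q, hQ⟩
    refine ⟨C a * Q, ?_⟩
    have := V.smul_mem (ι a) hQ
    rwa [smul_eq_mul, mul_add, ← map_mul, ← mul_assoc, ← eval₂_C_mul_noncomm] at this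

namespace IsDiffOpRing

theorem bijective_eval₂ (hS : IsDiffOpRing (⇑d) ι θ) :
    Function.Bijective (eval₂ ι θ) := by
  have h : eval₂ ι θ = fun p : R[X] => p.sum fun i a => ι a * θ ^ i :=
    funext fun p => eval₂_eq_sum
  exact h ▸ hS.basis

theorem eval₂_thetaMul (hS : IsDiffOpRing (⇑d) ι θ) (Q : R[X]) :
    eval₂ ι θ (thetaMul d Q) = θ * eval₂ ι θ Q := by
  induction Q using Polynomial.induction_on' with
  | add P Q hP hQ => simp only [map_add, mul_add, eval₂_add, hP, hQ]
  | monomial m b =>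
    rw [thetaMul_monomial, eval₂_add, eval₂_monomial, eval₂_monomial, eval₂_monomial,
      ← mul_assoc, hS.rel, add_mul, pow_succ', mul_assoc]

theorem eval₂_mul_theta_mem (hS : IsDiffOpRing (⇑d) ι θ) {Q : R[X]}
    (hQ : Q ∈ leftIdealSpan d p) :
    eval₂ ι θ Q * θ ∈ Submodule.span S ((fun r => ι r * θ) '' (p : Set R)) := by
  refine leftIdealSpan_induction (A := (Submodule.toAddSubgroup (Submodule.span S
    ((fun r => ι r * θ) '' (p : Set R)))).comap
      ((AddMonoidHom.mulRight θ).comp (eval₂AddMonoidHom ι θ))) ?_ hQ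
  intro k a ha
  simp only [AddSubgroup.mem_comap, AddMonoidHom.comp_apply, eval₂AddMonoidHom_apply,
    AddMonoidHom.coe_mulRight, Submodule.mem_toAddSubgroup]
  induction k with
  | zero =>
    rw [Function.iterate_zero_apply, eval₂_C]
    exact Submodule.subset_span ⟨a, ha, rfl⟩
  | succ k ih =>
    rw [Function.iterate_succ_apply', hS.eval₂_thetaMul, mul_assoc]
    exact Submodule.smul_mem _ θ ih

theorem mul_eval₂ (hS : IsDiffOpRing (⇑d) ι θ) (s : S) {Q : R[X]}
    (hQ : Q ∈ leftIdealSpan d p) :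
    ∃ Q' ∈ leftIdealSpan d p, eval₂ ι θ Q' = s * eval₂ ι θ Q := by
  obtain ⟨P, rfl⟩ := hS.bijective_eval₂.2 s
  induction P using Polynomial.induction_on' generalizing Q with
  | add P₁ P₂ h₁ h₂ =>
    obtain ⟨Q₁, hm₁, he₁⟩ := h₁ hQ
    obtain ⟨Q₂, hm₂, he₂⟩ := h₂ hQ
    exact ⟨Q₁ + Q₂, add_mem hm₁ hm₂, by rw [eval₂_add, eval₂_add, he₁, he₂, add_mul]⟩
  | monomial n a =>
    induction n generalizing Q with
    | zero =>
      refine ⟨C a * Q, C_mul_mem a hQ, ?_⟩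
      rw [eval₂_C_mul_noncomm, monomial_zero_left, eval₂_C]
    | succ n ih =>
      obtain ⟨Q', hm, he⟩ := ih (thetaMul_mem hQ)
      refine ⟨Q', hm, ?_⟩
      rw [he, hS.eval₂_thetaMul, eval₂_monomial, eval₂_monomial, pow_succ, mul_assoc, mul_assoc,
        mul_assoc]

theorem mem_leftIdealSpan_of_mul_theta_mem (hS : IsDiffOpRing (⇑d) ι θ) {Q : R[X]}
    (hQ : eval₂ ι θ Q * θ ∈ Submodule.span S ((fun r => ι r * θ) '' (p : Set R))) :
    Q ∈ leftIdealSpan d p := by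
  have key : ∀ x ∈ Submodule.span S ((fun r => ι r * θ) '' (p : Set R)),
      ∃ Q' ∈ leftIdealSpan d p, eval₂ ι θ Q' * θ = x := by
    intro x hx
    induction hx using Submodule.span_induction with
    | mem x hx =>
      obtain ⟨r, hr, rfl⟩ := hx
      exact ⟨C r, thetaMul_iterate_C_mem 0 hr, by rw [eval₂_C]⟩
    | zero => exact ⟨0, zero_mem _, by simp⟩
    | add x y _ _ hx hy =>
      obtain ⟨Q₁, hm₁, rfl⟩ := hx
      obtain ⟨Q₂, hm₂, rfl⟩ := hy
      exact ⟨Q₁ + Q₂, add_mem hm₁ hm₂, by rw [eval₂_add, add_mul]⟩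
    | smul s x _ hx =>
      obtain ⟨Q₁, hm₁, rfl⟩ := hx
      obtain ⟨Q₂, hm₂, he⟩ := hS.mul_eval₂ s hm₁
      exact ⟨Q₂, hm₂, by rw [he, smul_eq_mul, mul_assoc]⟩
  obtain ⟨Q', hm, he⟩ := key _ hQ
  rw [← eval₂_mul_X, ← eval₂_mul_X] at he
  have := hS.bijective_eval₂.1 he
  rwa [← isRegular_X.right this]

theorem exists_eq_add_mul_theta (hS : IsDiffOpRing (⇑d) ι θ) (s : S) :
    ∃ (r : R) (Q : R[X]), s = ι r + eval₂ ι θ Q * θ := by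
  obtain ⟨P, rfl⟩ := hS.bijective_eval₂.2 s
  refine ⟨P.coeff 0, P.divX, ?_⟩
  conv_lhs => rw [← divX_mul_X_add P]
  rw [eval₂_add, eval₂_mul_X, eval₂_C, add_comm]

theorem derivation_mem_constantTerms (hS : IsDiffOpRing (⇑d) ι θ) {V : Submodule S S} {a : R}
    (ha : a ∈ constantTerms ι θ V) : d a ∈ constantTerms ι θ V := by
  obtain ⟨Q, hQ⟩ := ha
  refine ⟨C a + thetaMul d Q, ?_⟩
  have := V.smul_mem θ hQ
  rwa [smul_eq_mul, mul_add, hS.rel, ← mul_assoc, ← hS.eval₂_thetaMul, add_comm (ι a * θ),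
    add_assoc, ← add_mul, ← eval₂_C (f := ι) (x := θ) (a := a), ← eval₂_add] at this

end IsDiffOpRing

end DiffOp

/-- Let `R` be a commutative ring with derivation `d` and `S = R[θ; d]`.  If `𝔭` is a
prime ideal of `R` containing no non-zero `d`-ideal, then `Sθ/I` is an essential left
`S`-submodule of `S/I`, where `I = S𝔭θ`. -/
theorem essential_over_prime
    (R : Type*) [CommRing R] (d : Derivation ℤ R R)
    (S : Type*) [Ring S] (ι : R →+* S) (θ : S) (hS : IsDiffOpRing (⇑d) ι θ)
    (p : Ideal R) (hp : p.IsPrime)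
    (hnod : ∀ J : Ideal R, (∀ a ∈ J, d a ∈ J) → J ≤ p → J = ⊥) :
    ∀ I : Submodule S S, I = Submodule.span S ((fun r => ι r * θ) '' (p : Set R)) →
      ∀ U : Submodule S (S ⧸ I),
        ((Submodule.span S {θ}).map I.mkQ) ⊓ U = ⊥ → U = ⊥ := by
  intro I hI U hU
  set V : Submodule S S := U.comap I.mkQ with hV
  have hinter : ∀ s, s * θ ∈ V → s * θ ∈ I := by
    intro s hs
    have hmem : I.mkQ (s * θ) ∈ ((Submodule.span S {θ}).map I.mkQ) ⊓ U :=
      ⟨Submodule.mem_map_of_mem (Submodule.mem_span_singleton.mpr ⟨s, rfl⟩), hs⟩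
    rw [hU, Submodule.mem_bot] at hmem
    exact (Submodule.Quotient.mk_eq_zero I).mp hmem
  have hIV : I ≤ V := fun x hx => by
    have : I.mkQ x = 0 := (Submodule.Quotient.mk_eq_zero I).mpr hx
    rw [hV, Submodule.mem_comap, this]
    exact U.zero_mem
  by_cases hJ : constantTerms ι θ V ≤ p
  · have hbot := hnod _ (fun a ha => hS.derivation_mem_constantTerms ha) hJ
    rw [eq_bot_iff]
    intro u hu
    obtain ⟨s, rfl⟩ := I.mkQ_surjective u
    obtain ⟨r, Q, rfl⟩ := hS.exists_eq_add_mul_theta s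
    have hr : r ∈ constantTerms ι θ V := ⟨Q, hu⟩
    rw [hbot, Ideal.mem_bot] at hr
    subst hr
    rw [map_zero, zero_add] at hu ⊢
    exact (Submodule.Quotient.mk_eq_zero I).mpr (hinter _ hu)
  · obtain ⟨r, ⟨Q, hQ⟩, hr⟩ := SetLike.not_le_iff_exists.mp hJ
    obtain ⟨Q₀, hQ₀, hlead⟩ := exists_sub_mem_leftIdealSpan d p Q
    have hred : ι r + Q₀.eval₂ ι θ * θ ∈ V := by
      have := V.sub_mem hQ (hIV (hI ▸ hS.eval₂_mul_theta_mem hQ₀))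
      rwa [Polynomial.eval₂_sub, sub_mul, add_sub_assoc, sub_sub_cancel] at this
    have hmul := V.smul_mem (ι r * θ - ι (d r)) hred
    have heq : (ι r * θ - ι (d r)) • (ι r + Q₀.eval₂ ι θ * θ) =
        (Polynomial.C (r * r) + (Polynomial.C r * thetaMul d Q₀ -
          Polynomial.C (d r) * Q₀)).eval₂ ι θ * θ := by
      have hcomm : ι (d r) * ι r = ι r * ι (d r) := by rw [← map_mul, ← map_mul, mul_comm]
      rw [Polynomial.eval₂_add, Polynomial.eval₂_sub, Polynomial.eval₂_C,
        eval₂_C_mul_noncomm, eval₂_C_mul_noncomm, hS.eval₂_thetaMul, smul_eq_mul,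
        sub_mul, mul_add, mul_assoc (ι r) θ (ι r), hS.rel, mul_add (ι (d r)), hcomm, map_mul]
      noncomm_ring
    rw [heq] at hmul
    exact absurd (hS.mem_leftIdealSpan_of_mul_theta_mem (hI ▸ hinter _ hmul))
      (C_sq_add_notMem_leftIdealSpan hp hr hlead)
end

section
/- Let R be a commutative Noetherian domain with derivation d such that R is not d-simple. Suppose R has a maximal ideal 𝔪 that does not contain any non-zero d-ideal and such that char(R/𝔪) = 0. Then, with S = R[θ; d], the cyclic left S-module S/S𝔪θ is a non-Artinian essential extension of the simple left S-module Sθ/S𝔪θ ≅ S/S𝔪. -/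
open Polynomial

namespace IsDiffOpRing

section Basis

variable {R S : Type*} [Ring R] [Ring S] {d : R → R} {ι : R →+* S} {θ : S}

/-- The additive map out of `S` with prescribed values on the elements `ι a * θ ^ i`. -/
noncomputable def lift (hS : IsDiffOpRing d ι θ) {A : Type*} [AddCommGroup A]
    (E : ℕ → R →+ A) : S →+ A where
  toFun s := ((Equiv.ofBijective _ hS.basis).symm s).sum fun i a => E i a
  map_zero' := by
    have h : (Equiv.ofBijective _ hS.basis).symm (0 : S) = 0 := by
      rw [Equiv.symm_apply_eq]
      simp
    rw [h]
    simp
  map_add' s t := by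
    have h : (Equiv.ofBijective _ hS.basis).symm (s + t) =
        (Equiv.ofBijective _ hS.basis).symm s + (Equiv.ofBijective _ hS.basis).symm t := by
      rw [Equiv.symm_apply_eq]
      conv_lhs => rw [← (Equiv.ofBijective _ hS.basis).apply_symm_apply s,
        ← (Equiv.ofBijective _ hS.basis).apply_symm_apply t]
      simp only [Equiv.ofBijective_apply]
      rw [Polynomial.sum_add_index] <;> simp [add_mul]
    rw [h, Polynomial.sum_add_index] <;> simp

theorem lift_apply (hS : IsDiffOpRing d ι θ) {A : Type*} [AddCommGroup A]
    (E : ℕ → R →+ A) (i : ℕ) (a : R) : hS.lift E (ι a * θ ^ i) = E i a := by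
  have h : (Equiv.ofBijective _ hS.basis).symm (ι a * θ ^ i) = monomial i a := by
    rw [Equiv.symm_apply_eq]
    simp [Polynomial.sum_monomial_index]
  change ((Equiv.ofBijective _ hS.basis).symm (ι a * θ ^ i)).sum _ = _
  rw [h, Polynomial.sum_monomial_index _ _ (by simp)]

@[elab_as_elim]
theorem induction_on (hS : IsDiffOpRing d ι θ) {P : S → Prop} (s : S)
    (hadd : ∀ s t, P s → P t → P (s + t)) (hmono : ∀ a i, P (ι a * θ ^ i)) : P s := by
  obtain ⟨p, rfl⟩ := hS.basis.2 s
  refine Finset.sum_induction _ P hadd ?_ fun i _ => hmono _ i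
  simpa using hmono 0 0

theorem addMonoidHom_ext (hS : IsDiffOpRing d ι θ) {A : Type*} [AddCommGroup A] {f g : S →+ A}
    (h : ∀ a i, f (ι a * θ ^ i) = g (ι a * θ ^ i)) (s : S) : f s = g s := by
  refine hS.induction_on s (fun s t hs ht => ?_) h
  rw [map_add, map_add, hs, ht]

theorem mul_mem (hS : IsDiffOpRing d ι θ) (H : AddSubgroup S)
    (hι : ∀ r, ∀ s ∈ H, ι r * s ∈ H) (hθ : ∀ s ∈ H, θ * s ∈ H) (t : S) :
    ∀ s ∈ H, t * s ∈ H := by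
  refine hS.induction_on t (fun t u ht hu s hs => ?_) fun a i => ?_
  · rw [add_mul]
    exact H.add_mem (ht s hs) (hu s hs)
  · have key : ∀ i, ∀ s ∈ H, θ ^ i * s ∈ H := by
      intro i
      induction i with
      | zero => simp
      | succ i ih =>
        intro s hs
        rw [pow_succ, mul_assoc]
        exact ih _ (hθ s hs)
    intro s hs
    rw [mul_assoc]
    exact hι a _ (key i s hs)

/-- The constant coefficient of an operator, with coefficients written on the left. -/
noncomputable def constCoeff (hS : IsDiffOpRing d ι θ) : S →+ R :=
  hS.lift fun i => if i = 0 then AddMonoidHom.id R else 0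

/-- The quotient of an operator by `θ` on the right. -/
noncomputable def divRight (hS : IsDiffOpRing d ι θ) : S →+ S :=
  hS.lift fun i => i.casesOn 0 fun j => (AddMonoidHom.mulRight (θ ^ j)).comp ι.toAddMonoidHom

@[simp]
theorem constCoeff_ι (hS : IsDiffOpRing d ι θ) (a : R) : hS.constCoeff (ι a) = a := by
  simpa [constCoeff] using
    hS.lift_apply (fun i => if i = 0 then AddMonoidHom.id R else 0) 0 a

@[simp]
theorem constCoeff_mul_θ (hS : IsDiffOpRing d ι θ) (s : S) : hS.constCoeff (s * θ) = 0 := by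
  refine hS.addMonoidHom_ext (f := hS.constCoeff.comp (AddMonoidHom.mulRight θ)) (g := 0)
    (fun a i => ?_) s
  simp only [AddMonoidHom.comp_apply, AddMonoidHom.mulRight_apply, mul_assoc, ← pow_succ]
  simp [constCoeff, lift_apply]

@[simp]
theorem divRight_ι (hS : IsDiffOpRing d ι θ) (a : R) : hS.divRight (ι a) = 0 := by
  simpa [divRight] using hS.lift_apply (fun i => i.casesOn 0 fun j =>
    (AddMonoidHom.mulRight (θ ^ j)).comp ι.toAddMonoidHom) 0 a

@[simp]
theorem divRight_mul_θ (hS : IsDiffOpRing d ι θ) (s : S) : hS.divRight (s * θ) = s := by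
  refine hS.addMonoidHom_ext (f := hS.divRight.comp (AddMonoidHom.mulRight θ))
    (g := AddMonoidHom.id S) (fun a i => ?_) s
  simp only [AddMonoidHom.comp_apply, AddMonoidHom.mulRight_apply, mul_assoc, ← pow_succ]
  simp [divRight, lift_apply]

theorem eq_constCoeff_add (hS : IsDiffOpRing d ι θ) (s : S) :
    s = ι (hS.constCoeff s) + hS.divRight s * θ := by
  refine hS.induction_on s (fun s t hs ht => ?_) fun a i => ?_
  · conv_lhs => rw [hs, ht]
    simp only [map_add, add_mul]
    abel
  · cases i with
    | zero => simp
    | succ i => simp [pow_succ, ← mul_assoc]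

theorem eq_divRight_mul (hS : IsDiffOpRing d ι θ) {s : S} (h : hS.constCoeff s = 0) :
    s = hS.divRight s * θ := by
  simpa [h] using hS.eq_constCoeff_add s

theorem ι_mul_eq (hS : IsDiffOpRing d ι θ) (r : R) (s : S) :
    ι r * s = ι (r * hS.constCoeff s) + (ι r * hS.divRight s) * θ := by
  conv_lhs => rw [hS.eq_constCoeff_add s]
  rw [mul_add, map_mul, mul_assoc]

theorem θ_mul_eq (hS : IsDiffOpRing d ι θ) (s : S) :
    θ * s = ι (d (hS.constCoeff s)) + (ι (hS.constCoeff s) + θ * hS.divRight s) * θ := by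
  conv_lhs => rw [hS.eq_constCoeff_add s]
  rw [mul_add, hS.rel, add_mul, mul_assoc]
  abel

@[simp]
theorem constCoeff_ι_mul (hS : IsDiffOpRing d ι θ) (r : R) (s : S) :
    hS.constCoeff (ι r * s) = r * hS.constCoeff s := by
  rw [hS.ι_mul_eq, map_add, constCoeff_ι, constCoeff_mul_θ, add_zero]

@[simp]
theorem constCoeff_θ_mul (hS : IsDiffOpRing d ι θ) (s : S) :
    hS.constCoeff (θ * s) = d (hS.constCoeff s) := by
  rw [hS.θ_mul_eq, map_add, constCoeff_ι, constCoeff_mul_θ, add_zero]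

@[simp]
theorem divRight_ι_mul (hS : IsDiffOpRing d ι θ) (r : R) (s : S) :
    hS.divRight (ι r * s) = ι r * hS.divRight s := by
  rw [hS.ι_mul_eq, map_add, divRight_ι, divRight_mul_θ, zero_add]

@[simp]
theorem divRight_θ_mul (hS : IsDiffOpRing d ι θ) (s : S) :
    hS.divRight (θ * s) = ι (hS.constCoeff s) + θ * hS.divRight s := by
  rw [hS.θ_mul_eq, map_add, divRight_ι, divRight_mul_θ, zero_add]

end Basis

section Symbol

variable {R S : Type*} [CommRing R] [Ring S] {d : Derivation ℤ R R} {ι : R →+* S} {θ : S}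

/-- The image of `ι a * θ ^ i` in `(R ⧸ m)[X]`, where `X ^ i` stands for `θ ^ i` and coefficients
are written on the right. -/
noncomputable def symbolMonomial (d : Derivation ℤ R R) (m : Ideal R) : ℕ → R →+ (R ⧸ m)[X]
  | 0 => (C.comp (Ideal.Quotient.mk m)).toAddMonoidHom
  | i + 1 => (AddMonoidHom.mulLeft X).comp (symbolMonomial d m i) -
      (symbolMonomial d m i).comp (d : R →ₗ[ℤ] R).toAddMonoidHom

theorem symbolMonomial_succ (m : Ideal R) (i : ℕ) (a : R) :
    symbolMonomial d m (i + 1) a = X * symbolMonomial d m i a - symbolMonomial d m i (d a) := rfl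

theorem coeff_symbolMonomial_of_lt (m : Ideal R) {i n : ℕ} (h : i < n) (a : R) :
    (symbolMonomial d m i a).coeff n = 0 := by
  induction i generalizing n a with
  | zero => exact coeff_C_of_ne_zero (by omega)
  | succ i ih =>
    obtain ⟨n, rfl⟩ : ∃ k, n = k + 1 := ⟨n - 1, by omega⟩
    rw [symbolMonomial_succ, coeff_sub, coeff_X_mul, ih (by omega), ih (by omega), sub_zero]

theorem coeff_symbolMonomial_self (m : Ideal R) (i : ℕ) (a : R) :
    (symbolMonomial d m i a).coeff i = Ideal.Quotient.mk m a := by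
  induction i with
  | zero => exact coeff_C_zero
  | succ i ih =>
    rw [symbolMonomial_succ, coeff_sub, coeff_X_mul, ih,
      coeff_symbolMonomial_of_lt m (Nat.lt_succ_self i), sub_zero]

theorem coeff_symbolMonomial_succ (m : Ideal R) (i : ℕ) (a : R) :
    (symbolMonomial d m (i + 1) a).coeff i = -((i + 1 : ℕ) * Ideal.Quotient.mk m (d a)) := by
  induction i with
  | zero =>
    rw [symbolMonomial_succ, coeff_sub, coeff_symbolMonomial_self]
    simp
  | succ i ih =>
    rw [symbolMonomial_succ, coeff_sub, coeff_X_mul, ih, coeff_symbolMonomial_self]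
    push_cast
    ring

/-- The additive map `S → (R ⧸ m)[X]` sending `θ ^ i * ι a` to `X ^ i * C a`. It identifies
`S ⧸ S m` with `(R ⧸ m)[X]`. -/
noncomputable def symbol (hS : IsDiffOpRing d ι θ) (m : Ideal R) : S →+ (R ⧸ m)[X] :=
  hS.lift (symbolMonomial d m)

theorem symbol_ι_mul_pow (hS : IsDiffOpRing d ι θ) (m : Ideal R) (a : R) (i : ℕ) :
    hS.symbol m (ι a * θ ^ i) = symbolMonomial d m i a :=
  hS.lift_apply _ i a

@[simp]
theorem symbol_ι (hS : IsDiffOpRing d ι θ) (m : Ideal R) (a : R) :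
    hS.symbol m (ι a) = C (Ideal.Quotient.mk m a) := by
  simpa using! hS.symbol_ι_mul_pow m a 0

theorem ι_mul_pow_succ (hS : IsDiffOpRing d ι θ) (a : R) (i : ℕ) :
    ι a * θ ^ (i + 1) = θ * (ι a * θ ^ i) - ι (d a) * θ ^ i := by
  rw [← mul_assoc, hS.rel, add_mul, pow_succ', mul_assoc]
  abel

@[simp]
theorem symbol_θ_mul (hS : IsDiffOpRing d ι θ) (m : Ideal R) (s : S) :
    hS.symbol m (θ * s) = X * hS.symbol m s := by
  refine hS.addMonoidHom_ext (f := (hS.symbol m).comp (AddMonoidHom.mulLeft θ))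
    (g := (AddMonoidHom.mulLeft X).comp (hS.symbol m)) (fun a i => ?_) s
  have h : θ * (ι a * θ ^ i) = ι a * θ ^ (i + 1) + ι (d a) * θ ^ i := by
    rw [hS.ι_mul_pow_succ]
    abel
  simp only [AddMonoidHom.comp_apply, AddMonoidHom.coe_mulLeft, h, map_add, symbol_ι_mul_pow,
    symbolMonomial_succ]
  abel

@[simp]
theorem symbol_pow_mul (hS : IsDiffOpRing d ι θ) (m : Ideal R) (i : ℕ) (s : S) :
    hS.symbol m (θ ^ i * s) = X ^ i * hS.symbol m s := by
  induction i with
  | zero => simp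
  | succ i ih => rw [pow_succ', mul_assoc, symbol_θ_mul, ih, pow_succ', mul_assoc]

@[simp]
theorem symbol_mul_ι (hS : IsDiffOpRing d ι θ) (m : Ideal R) (s : S) (r : R) :
    hS.symbol m (s * ι r) = hS.symbol m s * C (Ideal.Quotient.mk m r) := by
  refine hS.addMonoidHom_ext (f := (hS.symbol m).comp (AddMonoidHom.mulRight (ι r)))
    (g := (AddMonoidHom.mulRight (C (Ideal.Quotient.mk m r))).comp (hS.symbol m))
    (fun a i => ?_) s
  simp only [AddMonoidHom.comp_apply, AddMonoidHom.mulRight_apply]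
  induction i generalizing a with
  | zero => simp [← map_mul]
  | succ i ih =>
    rw [hS.ι_mul_pow_succ, sub_mul, map_sub, map_sub, sub_mul, ih, mul_assoc, symbol_θ_mul,
      symbol_θ_mul, ih, mul_assoc]

theorem closure_pow_mul_ι (hS : IsDiffOpRing d ι θ) (s : S) :
    s ∈ AddSubgroup.closure (Set.range fun x : ℕ × R => θ ^ x.1 * ι x.2) := by
  set H := AddSubgroup.closure (Set.range fun x : ℕ × R => θ ^ x.1 * ι x.2)
  have hgen : ∀ i a, θ ^ i * ι a ∈ H := fun i a => AddSubgroup.subset_closure ⟨(i, a), rfl⟩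
  have hθ : ∀ s ∈ H, θ * s ∈ H := by
    intro s hs
    induction hs using AddSubgroup.closure_induction with
    | mem x hx =>
      obtain ⟨⟨i, a⟩, rfl⟩ := hx
      simpa [pow_succ', mul_assoc] using hgen (i + 1) a
    | zero => simp
    | add x y _ _ hx hy => simpa [mul_add] using H.add_mem hx hy
    | neg x _ hx => simpa using hx
  have key : ∀ (i : ℕ) (a : R), ι a * θ ^ i ∈ H := by
    intro i
    induction i with
    | zero => intro a; simpa using hgen 0 a
    | succ i ih =>
      intro a
      rw [hS.ι_mul_pow_succ]
      exact H.sub_mem (hθ _ (ih a)) (ih _)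
  exact hS.induction_on s (fun _ _ => H.add_mem) fun a i => key i a

theorem exists_eq_sum_pow_mul_ι (hS : IsDiffOpRing d ι θ) (s : S) :
    ∃ p : R[X], s = p.sum fun i a => θ ^ i * ι a := by
  have hs := hS.closure_pow_mul_ι s
  induction hs using AddSubgroup.closure_induction with
  | mem x hx =>
    obtain ⟨⟨i, a⟩, rfl⟩ := hx
    exact ⟨monomial i a, by rw [sum_monomial_index _ _ (by simp)]⟩
  | zero => exact ⟨0, by simp⟩
  | add x y _ _ hx hy =>
    obtain ⟨p, rfl⟩ := hx
    obtain ⟨q, rfl⟩ := hy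
    exact ⟨p + q, by rw [Polynomial.sum_add_index] <;> simp [mul_add]⟩
  | neg x _ hx =>
    obtain ⟨p, rfl⟩ := hx
    exact ⟨-p, by simp [Polynomial.sum_def]⟩

theorem mem_span_iff_symbol_eq_zero (hS : IsDiffOpRing d ι θ) (m : Ideal R) (s : S) :
    s ∈ Submodule.span S (ι '' (m : Set R)) ↔ hS.symbol m s = 0 := by
  constructor
  · intro hs
    induction hs using Submodule.span_induction with
    | mem x hx =>
      obtain ⟨r, hr, rfl⟩ := hx
      simp [Ideal.Quotient.eq_zero_iff_mem.mpr hr]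
    | zero => simp
    | add x y _ _ hx hy => simp [hx, hy]
    | smul t x hx' hx =>
      clear hx
      have : ∀ t, hS.symbol m (t * x) = 0 := by
        induction hx' using Submodule.span_induction with
        | mem x hx =>
          obtain ⟨r, hr, rfl⟩ := hx
          simp [Ideal.Quotient.eq_zero_iff_mem.mpr hr]
        | zero => simp
        | add x y _ _ hx hy => simp [mul_add, hx, hy]
        | smul u x _ hx => intro t; simpa [mul_assoc] using hx (t * u)
      exact this t
  · intro h
    obtain ⟨p, rfl⟩ := hS.exists_eq_sum_pow_mul_ι s
    have hp : p.map (Ideal.Quotient.mk m) = 0 := by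
      rw [← h, Polynomial.sum_def, map_sum]
      conv_lhs => rw [p.as_sum_support_C_mul_X_pow, Polynomial.map_sum]
      refine Finset.sum_congr rfl fun i _ => ?_
      rw [symbol_pow_mul, symbol_ι, Polynomial.map_mul, map_C, Polynomial.map_pow, map_X, mul_comm]
    rw [Polynomial.sum_def]
    refine Submodule.sum_mem _ fun i _ => Submodule.smul_mem _ _
      (Submodule.subset_span ⟨_, ?_, rfl⟩)
    have := congrArg (fun q => q.coeff i) hp
    simpa [Ideal.Quotient.eq_zero_iff_mem] using this

theorem coeff_symbol_ι_mul (hS : IsDiffOpRing d ι θ) (m : Ideal R) (r : R) (s : S) {N : ℕ}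
    (hN : (hS.symbol m s).natDegree < N) (n : ℕ) :
    (hS.symbol m (ι r * s)).coeff n =
      ∑ i ∈ Finset.range N, (symbolMonomial d m i r).coeff n * (hS.symbol m s).coeff i := by
  choose g hg using fun i => Ideal.Quotient.mk_surjective ((hS.symbol m s).coeff i)
  set t := ∑ i ∈ Finset.range N, θ ^ i * ι (g i) with ht
  have hst : hS.symbol m (s - t) = 0 := by
    rw [map_sub, sub_eq_zero, ht, map_sum, (hS.symbol m s).as_sum_range_C_mul_X_pow' hN]
    refine Finset.sum_congr rfl fun i _ => ?_
    rw [symbol_pow_mul, symbol_ι, hg, mul_comm]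
  have hrst : hS.symbol m (ι r * (s - t)) = 0 := by
    rw [← mem_span_iff_symbol_eq_zero] at hst ⊢
    exact Submodule.smul_mem _ (ι r) hst
  rw [mul_sub, map_sub, sub_eq_zero] at hrst
  rw [hrst, ht, Finset.mul_sum, map_sum, finsetSum_coeff]
  refine Finset.sum_congr rfl fun i _ => ?_
  rw [← mul_assoc, symbol_mul_ι, coeff_mul_C, symbol_ι_mul_pow, hg]

theorem natDegree_symbol_ι_mul_le (hS : IsDiffOpRing d ι θ) (m : Ideal R) (r : R) (s : S) :
    (hS.symbol m (ι r * s)).natDegree ≤ (hS.symbol m s).natDegree := by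
  rw [natDegree_le_iff_coeff_eq_zero]
  intro n hn
  rw [hS.coeff_symbol_ι_mul m r s (Nat.lt_succ_self _)]
  refine Finset.sum_eq_zero fun i hi => ?_
  rw [coeff_symbolMonomial_of_lt m (by simp at hi; omega), zero_mul]

theorem natDegree_symbol_ι_mul_of_mem (hS : IsDiffOpRing d ι θ) (m : Ideal R) {r : R}
    (hr : r ∈ m) {s : S} {n : ℕ} (hn : (hS.symbol m s).natDegree = n + 1) :
    (hS.symbol m (ι r * s)).natDegree ≤ n := by
  rw [natDegree_le_iff_coeff_eq_zero]
  intro k hk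
  rw [hS.coeff_symbol_ι_mul m r s (Nat.lt_succ_self _), hn]
  refine Finset.sum_eq_zero fun i hi => ?_
  rw [Finset.mem_range] at hi
  rcases (show i < k ∨ i = k by omega) with h | rfl
  · rw [coeff_symbolMonomial_of_lt m h, zero_mul]
  · rw [coeff_symbolMonomial_self, Ideal.Quotient.eq_zero_iff_mem.mpr hr, zero_mul]

theorem coeff_symbol_ι_mul_of_mem (hS : IsDiffOpRing d ι θ) (m : Ideal R) {r : R}
    (hr : r ∈ m) {s : S} {n : ℕ} (hn : (hS.symbol m s).natDegree = n + 1) :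
    (hS.symbol m (ι r * s)).coeff n =
      -((n + 1 : ℕ) * Ideal.Quotient.mk m (d r)) * (hS.symbol m s).coeff (n + 1) := by
  rw [hS.coeff_symbol_ι_mul m r s (Nat.lt_succ_self _), hn, Finset.sum_range_succ,
    Finset.sum_range_succ, coeff_symbolMonomial_succ, coeff_symbolMonomial_self,
    Ideal.Quotient.eq_zero_iff_mem.mpr hr, zero_mul, add_zero, Finset.sum_eq_zero, zero_add]
  intro i hi
  rw [coeff_symbolMonomial_of_lt m (Finset.mem_range.mp hi), zero_mul]

theorem isCoatom_span (hS : IsDiffOpRing d ι θ) {m : Ideal R} (hmax : m.IsMaximal)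
    (hchar : CharZero (R ⧸ m)) {r : R} (hr : r ∈ m) (hdr : d r ∉ m) :
    IsCoatom (Submodule.span S (ι '' (m : Set R))) := by
  have : Nontrivial (R ⧸ m) := Ideal.Quotient.nontrivial_iff.mpr hmax.ne_top
  have : IsDomain (R ⧸ m) := Ideal.Quotient.isDomain m
  refine ⟨fun h => ?_, fun L hL => ?_⟩
  · have h1 : (1 : S) ∈ Submodule.span S (ι '' (m : Set R)) := h ▸ Submodule.mem_top
    rw [hS.mem_span_iff_symbol_eq_zero, ← map_one ι, symbol_ι] at h1
    simp at h1
  · obtain ⟨hle, s, hs, hs'⟩ := Set.ssubset_iff_exists.mp hL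
    have hs0 : hS.symbol m s ≠ 0 := fun h => hs' ((hS.mem_span_iff_symbol_eq_zero m s).mpr h)
    rw [Ideal.eq_top_iff_one (I := L)]
    obtain ⟨n, hn⟩ : ∃ n, (hS.symbol m s).natDegree = n := ⟨_, rfl⟩
    clear hs'
    induction n generalizing s with
    | zero =>
      obtain ⟨b, hb⟩ := Ideal.Quotient.mk_surjective ((hS.symbol m s).coeff 0)
      have hsb : hS.symbol m s = C (Ideal.Quotient.mk m b) := by
        rw [hb]
        exact eq_C_of_natDegree_eq_zero hn
      have hbm : b ∉ m := fun h => hs0 (by rw [hsb, Ideal.Quotient.eq_zero_iff_mem.mpr h, C_0])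
      obtain ⟨c, x, hx, hcx⟩ := hmax.exists_inv hbm
      have hbL : ι b ∈ L := by
        have : s - ι b ∈ L := hle (by
          rw [SetLike.mem_coe, hS.mem_span_iff_symbol_eq_zero, map_sub, symbol_ι, hsb, sub_self])
        simpa using L.sub_mem hs this
      have hxL : ι x ∈ L := hle (Submodule.subset_span ⟨x, hx, rfl⟩)
      rw [← map_one ι, ← hcx, map_add, map_mul]
      exact L.add_mem (L.smul_mem (ι c) hbL) hxL
    | succ n ih =>
      have hc : (hS.symbol m (ι r * s)).coeff n ≠ 0 := by
        rw [hS.coeff_symbol_ι_mul_of_mem m hr hn]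
        refine mul_ne_zero (neg_ne_zero.mpr (mul_ne_zero (by exact_mod_cast n.succ_ne_zero)
          fun h => hdr (Ideal.Quotient.eq_zero_iff_mem.mp h))) ?_
        rw [← hn]
        exact leadingCoeff_ne_zero.mpr hs0
      exact ih (ι r * s) (L.smul_mem (ι r) hs) (fun h => hc (by rw [h, coeff_zero]))
        (le_antisymm (hS.natDegree_symbol_ι_mul_of_mem m hr hn) (le_natDegree_of_ne_zero hc))

theorem mem_span_mul_θ_iff (ι : R →+* S) (θ : S) (m : Ideal R) (s : S) :
    s ∈ Submodule.span S ((fun r => ι r * θ) '' (m : Set R)) ↔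
      ∃ t ∈ Submodule.span S (ι '' (m : Set R)), s = t * θ := by
  have h : Submodule.span S ((fun r => ι r * θ) '' (m : Set R)) =
      (Submodule.span S (ι '' (m : Set R))).map (LinearMap.toSpanSingleton S S θ) := by
    rw [Submodule.map_span, ← Set.image_comp]
    rfl
  rw [h, Submodule.mem_map]
  simp [eq_comm]

theorem mul_θ_mem_span_iff (hS : IsDiffOpRing d ι θ) (m : Ideal R) (s : S) :
    s * θ ∈ Submodule.span S ((fun r => ι r * θ) '' (m : Set R)) ↔
      s ∈ Submodule.span S (ι '' (m : Set R)) := by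
  rw [mem_span_mul_θ_iff]
  refine ⟨?_, fun h => ⟨s, h, rfl⟩⟩
  rintro ⟨t, ht, hst⟩
  have := congrArg hS.divRight hst
  rw [divRight_mul_θ, divRight_mul_θ] at this
  rwa [this]

theorem constCoeff_eq_zero_of_mem_span (hS : IsDiffOpRing d ι θ) (m : Ideal R) {s : S}
    (hs : s ∈ Submodule.span S ((fun r => ι r * θ) '' (m : Set R))) :
    hS.constCoeff s = 0 := by
  obtain ⟨t, -, rfl⟩ := (mem_span_mul_θ_iff ι θ m s).mp hs
  exact hS.constCoeff_mul_θ t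

/-- The left ideal of operators with constant coefficient in a given `d`-ideal. -/
noncomputable def comapConstCoeff (hS : IsDiffOpRing d ι θ) (J : Ideal R)
    (hJ : ∀ a ∈ J, d a ∈ J) : Submodule S S where
  carrier := {s | hS.constCoeff s ∈ J}
  zero_mem' := by simp
  add_mem' {s t} hs ht := by
    simp only [Set.mem_ofPred_eq, map_add] at *
    exact J.add_mem hs ht
  smul_mem' t s hs := by
    refine hS.mul_mem (J.toAddSubgroup.comap hS.constCoeff) (fun r s hs => ?_)
      (fun s hs => ?_) t s hs
    · simp only [AddSubgroup.mem_comap, constCoeff_ι_mul] at *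
      exact J.mul_mem_left r hs
    · simp only [AddSubgroup.mem_comap, constCoeff_θ_mul] at *
      exact hJ _ hs

theorem map_mem_pow {J : Ideal R} (hJ : ∀ a ∈ J, d a ∈ J) (n : ℕ) :
    ∀ a ∈ J ^ n, d a ∈ J ^ n := by
  induction n with
  | zero => simp
  | succ n ih =>
    intro a ha
    rw [pow_succ] at ha ⊢
    induction ha using Submodule.mul_induction_on' with
    | mem_mul_mem x hx y hy =>
      rw [Derivation.leibniz, smul_eq_mul, smul_eq_mul, mul_comm y]
      exact Ideal.add_mem _ (Ideal.mul_mem_mul hx (hJ y hy)) (Ideal.mul_mem_mul (ih x hx) hy)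
    | add x _ y _ hx hy =>
      rw [map_add]
      exact Ideal.add_mem _ hx hy

theorem not_isArtinian [IsDomain R] [IsNoetherianRing R] (hS : IsDiffOpRing d ι θ) (m : Ideal R)
    {J : Ideal R} (hJ : ∀ a ∈ J, d a ∈ J) (hbot : J ≠ ⊥) (htop : J ≠ ⊤) :
    ¬ IsArtinian S (S ⧸ Submodule.span S ((fun r => ι r * θ) '' (m : Set R))) := by
  intro hA
  set I := Submodule.span S ((fun r => ι r * θ) '' (m : Set R))
  let L : ℕ → Submodule S S := fun n => hS.comapConstCoeff (J ^ n) (map_mem_pow hJ n)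
  let f : ℕ →o (Submodule S (S ⧸ I))ᵒᵈ :=
    { toFun := fun n => OrderDual.toDual ((L n).map I.mkQ)
      monotone' := fun a b hab =>
        OrderDual.toDual_le_toDual.mpr
          (Submodule.map_mono fun s hs => Ideal.pow_le_pow_right hab hs) }
  obtain ⟨n, hn⟩ := IsArtinian.monotone_stabilizes f
  have hle : ∀ k, n ≤ k → J ^ n ≤ J ^ k := by
    intro k hk a ha
    have hk' : (L n).map I.mkQ = (L k).map I.mkQ := hn k hk
    have haL : I.mkQ (ι a) ∈ (L n).map I.mkQ :=
      Submodule.mem_map_of_mem (show hS.constCoeff (ι a) ∈ J ^ n by simpa using ha)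
    rw [hk'] at haL
    obtain ⟨s, hs, hsa⟩ := haL
    have h0 : hS.constCoeff (s - ι a) = 0 :=
      hS.constCoeff_eq_zero_of_mem_span m ((Submodule.Quotient.eq I).mp hsa)
    rw [map_sub, constCoeff_ι, sub_eq_zero] at h0
    exact h0 ▸ hs
  have hidem : IsIdempotentElem (J ^ (n + 1)) := by
    refine le_antisymm Ideal.mul_le_right ?_
    rw [← pow_add]
    exact (Ideal.pow_le_pow_right n.le_succ).trans (hle _ (by omega))
  rcases (Ideal.isIdempotentElem_iff_eq_bot_or_top _ (IsNoetherian.noetherian _)).mp hidem with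
    h | h
  · exact hbot (eq_zero_of_pow_eq_zero h)
  · exact htop (top_le_iff.mp (h ▸ Ideal.pow_le_self n.succ_ne_zero))

/-- The constant coefficients of those elements of a left ideal whose right quotient by `θ` has
symbol of degree at most `n`. -/
noncomputable def boundedConstCoeff (hS : IsDiffOpRing d ι θ) (m : Ideal R) (L : Submodule S S)
    (n : ℕ) : Ideal R where
  carrier := {a | ∃ s ∈ L, hS.constCoeff s = a ∧ (hS.symbol m (hS.divRight s)).natDegree ≤ n}
  zero_mem' := ⟨0, L.zero_mem, by simp, by simp⟩
  add_mem' := by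
    rintro _ _ ⟨s, hs, rfl, hsn⟩ ⟨t, ht, rfl, htn⟩
    refine ⟨s + t, L.add_mem hs ht, map_add _ _ _, ?_⟩
    rw [map_add, map_add]
    exact natDegree_add_le_of_degree_le hsn htn
  smul_mem' := by
    rintro r _ ⟨s, hs, rfl, hsn⟩
    refine ⟨ι r * s, L.smul_mem (ι r) hs, hS.constCoeff_ι_mul r s, ?_⟩
    rw [divRight_ι_mul]
    exact (hS.natDegree_symbol_ι_mul_le m r _).trans hsn

theorem boundedConstCoeff_mono (hS : IsDiffOpRing d ι θ) (m : Ideal R) (L : Submodule S S) :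
    Monotone (hS.boundedConstCoeff m L) := by
  rintro a b hab _ ⟨s, hs, hsa, hsn⟩
  exact ⟨s, hs, hsa, hsn.trans hab⟩

/-- The constant coefficients of the elements of a left ideal. -/
noncomputable def mapConstCoeff (hS : IsDiffOpRing d ι θ) (L : Submodule S S) : Ideal R where
  carrier := {a | ∃ s ∈ L, hS.constCoeff s = a}
  zero_mem' := ⟨0, L.zero_mem, by simp⟩
  add_mem' := by
    rintro _ _ ⟨s, hs, rfl⟩ ⟨t, ht, rfl⟩
    exact ⟨s + t, L.add_mem hs ht, map_add _ _ _⟩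
  smul_mem' := by
    rintro r _ ⟨s, hs, rfl⟩
    exact ⟨ι r * s, L.smul_mem (ι r) hs, hS.constCoeff_ι_mul r s⟩

theorem symbol_divRight_eq_zero [IsNoetherianRing R] (hS : IsDiffOpRing d ι θ) {m : Ideal R}
    (hmax : m.IsMaximal) {L : Submodule S S}
    (hL : ∀ s ∈ L, hS.constCoeff s = 0 → hS.symbol m (hS.divRight s) = 0) :
    ∀ s ∈ L, hS.symbol m (hS.divRight s) = 0 := by
  have : Nontrivial (R ⧸ m) := Ideal.Quotient.nontrivial_iff.mpr hmax.ne_top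
  obtain ⟨n, hn⟩ := monotone_stabilizes_iff_noetherian.mpr ‹IsNoetherianRing R›
    ⟨hS.boundedConstCoeff m L, hS.boundedConstCoeff_mono m L⟩
  have hbound : ∀ s ∈ L, (hS.symbol m (hS.divRight s)).natDegree ≤ n := by
    intro s hs
    have hmem : hS.constCoeff s ∈ hS.boundedConstCoeff m L n := by
      have h : hS.boundedConstCoeff m L n = _ :=
        hn (max n (hS.symbol m (hS.divRight s)).natDegree) (le_max_left _ _)
      rw [h]
      exact ⟨s, hs, rfl, le_max_right _ _⟩
    obtain ⟨t, ht, hts, htn⟩ := hmem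
    have h0 := hL (s - t) (L.sub_mem hs ht) (by rw [map_sub, hts, sub_self])
    rw [map_sub, map_sub, sub_eq_zero] at h0
    rwa [h0]
  have hgrow : ∀ k, ∀ s ∈ L, hS.symbol m (hS.divRight s) ≠ 0 →
      ∃ t ∈ L, k ≤ (hS.symbol m (hS.divRight t)).natDegree ∧
        hS.symbol m (hS.divRight t) ≠ 0 := by
    intro k s hs hs0
    induction k with
    | zero => exact ⟨s, hs, Nat.zero_le _, hs0⟩
    | succ k ih =>
      obtain ⟨t, ht, hkt, ht0⟩ := ih
      have hdeg : (hS.symbol m (hS.divRight (θ * t))).natDegree =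
          (hS.symbol m (hS.divRight t)).natDegree + 1 := by
        rw [divRight_θ_mul, map_add, symbol_ι, symbol_θ_mul, natDegree_C_add, natDegree_X_mul ht0]
      refine ⟨θ * t, L.smul_mem θ ht, by omega, fun h => ?_⟩
      rw [h, natDegree_zero] at hdeg
      omega
  intro s hs
  by_contra hs0
  obtain ⟨t, ht, hnt, -⟩ := hgrow (n + 1) s hs hs0
  exact absurd (hbound t ht) (by omega)

theorem constCoeff_eq_zero [IsNoetherianRing R] (hS : IsDiffOpRing d ι θ) {m : Ideal R}
    (hmax : m.IsMaximal) (hnod : ∀ J : Ideal R, (∀ a ∈ J, d a ∈ J) → J ≤ m → J = ⊥)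
    {L : Submodule S S}
    (hL : ∀ s ∈ L, hS.constCoeff s = 0 → hS.symbol m (hS.divRight s) = 0) :
    ∀ s ∈ L, hS.constCoeff s = 0 := by
  have h0 := hS.symbol_divRight_eq_zero hmax hL
  have hbot : hS.mapConstCoeff L = ⊥ := by
    refine hnod _ ?_ ?_
    · rintro _ ⟨s, hs, rfl⟩
      exact ⟨θ * s, L.smul_mem θ hs, hS.constCoeff_θ_mul s⟩
    · rintro _ ⟨s, hs, rfl⟩
      have h := h0 (θ * s) (L.smul_mem θ hs)
      rw [divRight_θ_mul, map_add, symbol_ι, symbol_θ_mul, h0 s hs, mul_zero, add_zero, C_eq_zero,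
        Ideal.Quotient.eq_zero_iff_mem] at h
      exact h
  intro s hs
  have : hS.constCoeff s ∈ hS.mapConstCoeff L := ⟨s, hs, rfl⟩
  rwa [hbot, Ideal.mem_bot] at this

end Symbol

end IsDiffOpRing

/-- Let `R` be a commutative Noetherian domain with derivation `d` that is not
`d`-simple, and let `𝔪` be a maximal ideal of `R` containing no non-zero `d`-ideal with
`char(R/𝔪) = 0`.  Then, with `S = R[θ; d]` and `I = S𝔪θ`, the cyclic left `S`-module
`S/I` is a non-Artinian essential extension of the simple module `Sθ/I ≅ S/S𝔪`. -/
theorem nonartinian_essential_extension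
    (R : Type*) [CommRing R] [IsDomain R] [IsNoetherianRing R]
    (d : Derivation ℤ R R)
    (hnotsimple : ∃ J : Ideal R, (∀ a ∈ J, d a ∈ J) ∧ J ≠ ⊥ ∧ J ≠ ⊤)
    (S : Type*) [Ring S] (ι : R →+* S) (θ : S) (hS : IsDiffOpRing (⇑d) ι θ)
    (m : Ideal R) (hmax : m.IsMaximal)
    (hnod : ∀ J : Ideal R, (∀ a ∈ J, d a ∈ J) → J ≤ m → J = ⊥)
    (hchar : CharZero (R ⧸ m)) :
    ∀ I : Submodule S S, I = Submodule.span S ((fun r => ι r * θ) '' (m : Set R)) →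
      ∀ N : Submodule S (S ⧸ I), N = (Submodule.span S {θ}).map I.mkQ →
        (∀ N' : Submodule S (S ⧸ I), N ⊓ N' = ⊥ → N' = ⊥) ∧
        IsSimpleModule S ↥N ∧
        Nonempty ((S ⧸ (Submodule.span S (ι '' (m : Set R)) : Submodule S S)) ≃ₗ[S] ↥N) ∧
        ¬ IsArtinian S (S ⧸ I) := by
  rintro I rfl N rfl
  obtain ⟨J, hJd, hJbot, hJtop⟩ := hnotsimple
  obtain ⟨r, hr, hdr⟩ : ∃ r ∈ m, d r ∉ m := by
    by_contra! h
    obtain rfl := hnod m h le_rfl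
    exact hJtop (hmax.out.2 J (bot_lt_iff_ne_bot.mpr hJbot))
  set I := Submodule.span S ((fun r => ι r * θ) '' (m : Set R))
  let φ : S →ₗ[S] S ⧸ I := LinearMap.toSpanSingleton S (S ⧸ I) (I.mkQ θ)
  have hφ : ∀ s, φ s = I.mkQ (s * θ) := fun s => (map_smul I.mkQ s θ).symm
  have hrange : LinearMap.range φ = (Submodule.span S {θ}).map I.mkQ := by
    rw [Submodule.map_span, Set.image_singleton, LinearMap.range_toSpanSingleton]
  have hker : LinearMap.ker φ = Submodule.span S (ι '' (m : Set R)) := by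
    ext s
    rw [LinearMap.mem_ker, hφ, Submodule.mkQ_apply, Submodule.Quotient.mk_eq_zero,
      hS.mul_θ_mem_span_iff]
  let e : (S ⧸ Submodule.span S (ι '' (m : Set R))) ≃ₗ[S] (Submodule.span S {θ}).map I.mkQ :=
    (Submodule.quotEquivOfEq _ _ hker.symm).trans
      (φ.quotKerEquivRange.trans (LinearEquiv.ofEq _ _ hrange))
  refine ⟨fun N' hN' => ?_, ?_, ⟨e⟩, hS.not_isArtinian m hJd hJbot hJtop⟩
  · have hzero : ∀ s ∈ N'.comap I.mkQ, hS.constCoeff s = 0 → s ∈ I := by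
      intro s hs h0
      have hsN : I.mkQ s ∈ (Submodule.span S {θ}).map I.mkQ ⊓ N' := by
        refine ⟨Submodule.mem_map_of_mem ?_, hs⟩
        rw [hS.eq_divRight_mul h0]
        exact Submodule.smul_mem _ _ (Submodule.mem_span_singleton_self θ)
      rw [hN', Submodule.mem_bot] at hsN
      exact (Submodule.Quotient.mk_eq_zero I).mp hsN
    have hconst := hS.constCoeff_eq_zero hmax hnod (L := N'.comap I.mkQ) fun s hs h0 => by
      have hsI := hzero s hs h0
      rw [hS.eq_divRight_mul h0, hS.mul_θ_mem_span_iff, hS.mem_span_iff_symbol_eq_zero] at hsI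
      exact hsI
    rw [Submodule.eq_bot_iff]
    intro x hx
    obtain ⟨s, rfl⟩ := I.mkQ_surjective x
    exact (Submodule.Quotient.mk_eq_zero I).mpr (hzero s hx (hconst s hx))
  · have : IsSimpleModule S (S ⧸ Submodule.span S (ι '' (m : Set R))) :=
      isSimpleModule_iff_isCoatom.mpr (hS.isCoatom_span hmax hchar hr hdr)
    exact IsSimpleModule.congr e.symm
end

section
/- Let K be a field of characteristic 0 and let d = f ∂/∂x be a K-linear derivation of R = K[x], where f ∈ K[x] is not constant. If α ∈ K is not a root of f, then the maximal ideal 𝔪 = ⟨x − α⟩ of K[x] does not contain any non-zero d-ideal; in particular K[x] is d-primitive. -/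
open Polynomial

/-- An ideal of `K[X]` stable under `f ∂/∂X` and contained in `⟨X - α⟩`, where `f α ≠ 0`,
contains only zero. -/
theorem eq_zero_of_mem_of_stable_of_le_span {K : Type*} [Field K] [CharZero K] {f : K[X]} {α : K}
    (hα : f.eval α ≠ 0) {I : Ideal K[X]} (hI : ∀ g ∈ I, f * derivative g ∈ I)
    (hle : I ≤ Ideal.span {X - C α}) {g : K[X]} (hg : g ∈ I) : g = 0 := by
  induction hn : g.rootMultiplicity α using Nat.strong_induction_on generalizing g with
  | _ n ih =>
    by_contra hg0
    have hroot : g.IsRoot α := dvd_iff_isRoot.mp (Ideal.mem_span_singleton.mp (hle hg))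
    have hder : derivative g ≠ 0 := fun h => by
      rw [eq_C_of_derivative_eq_zero h] at hroot hg0
      simp_all
    have hf0 : f ≠ 0 := by
      rintro rfl
      simp at hα
    have hpos : 0 < g.rootMultiplicity α := (rootMultiplicity_pos hg0).mpr hroot
    have hmul : (f * derivative g).rootMultiplicity α < n := by
      rw [rootMultiplicity_mul (mul_ne_zero hf0 hder), rootMultiplicity_eq_zero hα,
        derivative_rootMultiplicity_of_root hroot]
      omega
    exact mul_ne_zero hf0 hder (ih _ hmul (hI g hg) rfl)

/-- Let `K` be a field of characteristic `0` and `d = f ∂/∂x` a derivation of `K[x]`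
with `f` non-constant.  If `α` is not a root of `f`, then the maximal ideal
`𝔪 = ⟨x - α⟩` contains no non-zero `d`-ideal; in particular `K[x]` is `d`-primitive. -/
theorem maximal_ideal_no_nonzero_dideal
    (K : Type*) [Field K] [CharZero K]
    (f : Polynomial K) (hf : 0 < f.natDegree)
    (α : K) (hα : f.eval α ≠ 0) :
    (Ideal.span {X - C α} : Ideal (Polynomial K)).IsMaximal ∧
    (∀ I : Ideal (Polynomial K), (∀ g ∈ I, f * derivative g ∈ I) →
      I ≤ Ideal.span {X - C α} → I = ⊥) ∧
    ∃ m : Ideal (Polynomial K), m.IsMaximal ∧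
      ∀ I : Ideal (Polynomial K), (∀ g ∈ I, f * derivative g ∈ I) → I ≠ ⊥ → ¬ I ≤ m := by
  have hmax : (Ideal.span {X - C α} : Ideal K[X]).IsMaximal :=
    PrincipalIdealRing.isMaximal_of_irreducible (irreducible_X_sub_C α)
  have hbot : ∀ I : Ideal K[X], (∀ g ∈ I, f * derivative g ∈ I) →
      I ≤ Ideal.span {X - C α} → I = ⊥ := fun I hI hle =>
    (Submodule.eq_bot_iff I).mpr fun _ hg => eq_zero_of_mem_of_stable_of_le_span hα hI hle hg
  exact ⟨hmax, hbot, _, hmax, fun I hI hne hle => hne (hbot I hI hle)⟩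
end

section
/- Let R be a ring with a locally nilpotent derivation d. Then every non-zero d-stable left ideal of R intersects the subring of constants R^d non-trivially. -/
/-- If `d` is a locally nilpotent derivation of a ring `R`, then every non-zero
`d`-stable left ideal of `R` contains a non-zero constant, i.e. intersects the subring
of constants `R^d` non-trivially. -/
theorem dstable_ideal_meets_constants
    (R : Type*) [Ring R] (d : R → R)
    (hadd : ∀ a b : R, d (a + b) = d a + d b)
    (hmul : ∀ a b : R, d (a * b) = d a * b + a * d b)
    (hln : ∀ a : R, ∃ n : ℕ, 0 < n ∧ d^[n] a = 0) :
    ∀ I : Submodule R R, (∀ a ∈ I, d a ∈ I) → I ≠ ⊥ →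
      ∃ a ∈ I, a ≠ 0 ∧ d a = 0 := by
  intro I hI hne
  obtain ⟨a, haI, ha⟩ := I.exists_mem_ne_zero_of_ne_bot hne
  obtain ⟨n, -, hn⟩ := hln a
  clear hne
  induction n generalizing a with
  | zero => exact absurd hn ha
  | succ n ih =>
    by_cases hda : d a = 0
    · exact ⟨a, haI, ha, hda⟩
    · exact ih (d a) (hI a haI) hda (by rwa [Function.iterate_succ_apply] at hn)
end
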